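/- There exist a constant ε > 0 and an integer d < ∞ such that lim_{n→∞} P[Y ∈ 𝓨(n,d) : h_1(Y) > ε] = 1; that is, the 2-dimensional complex Y(L_1,…,L_d) built from d independent uniform random Latin squares of order n is asymptotically almost surely a coboundary ε-expander in dimension 1 (and its maximal edge degree is at most d). -/

import Mathlib

open Finset
open scoped Classical

noncomputable section

/-- A Latin square of order `n`: an `n`-tuple `(π_1,…,π_n)` of permutations of `[n]`
such that `π_i ∘ π_j⁻¹` is fixed-point-free for all `i ≠ j`. -/
def IsLatinSquare {n : ℕ} (L : Fin n → Equiv.Perm (Fin n)) : Prop :=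
  ∀ i j : Fin n, i ≠ j → ∀ x : Fin n, L i x ≠ L j x

/-- The (finite) space of Latin squares of order `n`. -/
abbrev LatinSquare (n : ℕ) := {L : Fin n → Equiv.Perm (Fin n) // IsLatinSquare L}

/-- A `1`-cochain of the complete `3`-partite complex `T_n` (whose vertex set is
`V_1 ∪ V_2 ∪ V_3`, three copies of `Fin n`), recorded by its values on the three
kinds of edges `a_i b_j`, `a_i c_k`, `b_j c_k`. -/
structure Cochain1 (n : ℕ) where
  ab : Fin n → Fin n → ZMod 2
  ac : Fin n → Fin n → ZMod 2
  bc : Fin n → Fin n → ZMod 2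

instance {n : ℕ} : Add (Cochain1 n) :=
  ⟨fun φ η => ⟨fun i j => φ.ab i j + η.ab i j, fun i k => φ.ac i k + η.ac i k,
    fun j k => φ.bc j k + η.bc j k⟩⟩

/-- The coboundary of a `0`-cochain on `T_n`; vertices are indexed by `Fin 3 × Fin n`. -/
def d0 {n : ℕ} (ψ : Fin 3 × Fin n → ZMod 2) : Cochain1 n :=
  ⟨fun i j => ψ (0, i) + ψ (1, j), fun i k => ψ (0, i) + ψ (2, k),
   fun j k => ψ (1, j) + ψ (2, k)⟩

/-- `φ ∈ B^1`, i.e. `φ` is a `1`-coboundary. -/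
def IsCobound1 {n : ℕ} (φ : Cochain1 n) : Prop := ∃ ψ, φ = d0 ψ

/-- `‖φ‖ = |supp φ|` for a `1`-cochain. -/
def norm1 {n : ℕ} (φ : Cochain1 n) : ℕ :=
  (univ.filter fun p : Fin n × Fin n => φ.ab p.1 p.2 ≠ 0).card +
    (univ.filter fun p : Fin n × Fin n => φ.ac p.1 p.2 ≠ 0).card +
    (univ.filter fun p : Fin n × Fin n => φ.bc p.1 p.2 ≠ 0).card

/-- `‖[φ]‖ = min {‖φ + d_0 ψ‖ : ψ ∈ C^0}`. -/
def normClass1 {n : ℕ} (φ : Cochain1 n) : ℕ :=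
  sInf (Set.range fun ψ : Fin 3 × Fin n → ZMod 2 => norm1 (φ + d0 ψ))

/-- The coboundary of a `1`-cochain evaluated on the triangle `[a_i, b_j, c_k]`. -/
def d1 {n : ℕ} (φ : Cochain1 n) (i j k : Fin n) : ZMod 2 :=
  φ.ab i j + φ.ac i k + φ.bc j k

/-- The set of `2`-simplices `[a_i, b_j, c_{π_{mi}(j)}]` of `Y(L_1,…,L_d)`. -/
def triangles {n d : ℕ} (Ls : Fin d → LatinSquare n) : Finset (Fin n × Fin n × Fin n) :=
  univ.filter fun t => ∃ m : Fin d, ((Ls m).1 t.1) t.2.1 = t.2.2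

/-- `‖d_1 φ‖_Y`, where `Y ⊆ T_n` has full `1`-skeleton and triangle set `T`. -/
def normd1 {n : ℕ} (T : Finset (Fin n × Fin n × Fin n)) (φ : Cochain1 n) : ℕ :=
  (T.filter fun t => d1 φ t.1 t.2.1 t.2.2 ≠ 0).card

/-- The first coboundary expansion constant `h_1(Y)` of the subcomplex `Y ⊆ T_n` with
full `1`-skeleton and triangle set `T`:
`h_1 = min { ‖d_1 φ‖ / ‖[φ]‖ : φ ∈ C^1 ∖ B^1 }`. -/
def h1 {n : ℕ} (T : Finset (Fin n × Fin n × Fin n)) : ℝ :=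
  sInf {r : ℝ | ∃ φ : Cochain1 n, ¬ IsCobound1 φ ∧
    r = (normd1 T φ : ℝ) / (normClass1 φ : ℝ)}

/-- Every edge of the complex with triangle set `T` lies in at most `d` of its triangles. -/
def edgeDegLE {n : ℕ} (T : Finset (Fin n × Fin n × Fin n)) (d : ℕ) : Prop :=
  (∀ i j : Fin n, (T.filter fun t => t.1 = i ∧ t.2.1 = j).card ≤ d) ∧
    (∀ i k : Fin n, (T.filter fun t => t.1 = i ∧ t.2.2 = k).card ≤ d) ∧
    (∀ j k : Fin n, (T.filter fun t => t.2.1 = j ∧ t.2.2 = k).card ≤ d)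



/-- restriction of a multivariate polynomial to a coordinate line -/
def linP {ι A : Type} [DecidableEq ι] [CommRing A] [Algebra ℝ A] (x : ι → A) (j : ι)
    (p : MvPolynomial ι ℝ) : Polynomial A :=
  MvPolynomial.aeval (fun i => Polynomial.C (x i) + if i = j then Polynomial.X else 0) p

lemma linP_eval {ι A : Type} [DecidableEq ι] [CommRing A] [Algebra ℝ A] (x : ι → A) (j : ι)
    (p : MvPolynomial ι ℝ) (s : A) :
    (linP x j p).eval s = MvPolynomial.aeval (fun i => x i + if i = j then s else 0) p := by
  unfold linP
  induction p using MvPolynomial.induction_on with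
  | C a => simp [MvPolynomial.algebraMap_eq, Polynomial.algebraMap_eq, IsScalarTower.algebraMap_apply ℝ A (Polynomial A)]
  | add p q hp hq => simp [hp, hq]
  | mul_X p i hp => 
    rw [map_mul, map_mul, Polynomial.eval_mul, hp]
    congr 1
    by_cases h : i = j <;> simp [h]

lemma linP_derivative {ι A : Type} [DecidableEq ι] [CommRing A] [Algebra ℝ A] (x : ι → A) (j : ι)
    (p : MvPolynomial ι ℝ) :
    Polynomial.derivative (linP x j p) = linP x j (MvPolynomial.pderiv j p) := by
  unfold linP
  induction p using MvPolynomial.induction_on with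
  | C a => simp [IsScalarTower.algebraMap_apply ℝ A (Polynomial A)]
  | add p q hp hq => simp [hp, hq]
  | mul_X p i hp =>
    rw [map_mul, Polynomial.derivative_mul, hp, MvPolynomial.pderiv_mul, map_add, map_mul, map_mul]
    congr 2
    by_cases h : i = j
    · subst h; simp
    · simp [h, MvPolynomial.pderiv_X_of_ne h]

def StableP {ι : Type} (p : MvPolynomial ι ℝ) : Prop :=
  ∀ x : ι → ℂ, (∀ j, 0 ≤ (x j).im) → (∃ j, 0 < (x j).im) → MvPolynomial.aeval x p ≠ 0

lemma homog_smul {ι : Type} [Fintype ι] {p : MvPolynomial ι ℝ} {m : ℕ} (h : p.IsHomogeneous m)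
    (w : ℂ) (x : ι → ℂ) : MvPolynomial.aeval (fun i => w * x i) p = w ^ m * MvPolynomial.aeval x p := by
  simp only [MvPolynomial.aeval_def, MvPolynomial.eval₂_eq, Finset.mul_sum]
  refine Finset.sum_congr rfl fun d hd => ?_
  have hd' : d.degree = m := by
    have := h (MvPolynomial.mem_support_iff.mp hd)
    rw [Finsupp.degree_eq_weight_one]; exact this
  simp only [mul_pow, Finset.prod_mul_distrib, Finset.prod_pow_eq_pow_sum]
  have : ∑ i ∈ d.support, d i = m := by rw [← hd']; rfl
  rw [this]; ring

lemma StableP.pderiv {ι : Type} [DecidableEq ι] [Fintype ι] {p : MvPolynomial ι ℝ} {m : ℕ}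
    (hp : StableP p) (hh : p.IsHomogeneous (m + 1)) (j : ι) :
    StableP (MvPolynomial.pderiv j p) := by
  intro x hx hx' h0
  set q := linP x j p with hq
  have hroot : ∀ s : ℂ, 0 ≤ s.im → q.eval s ≠ 0 := by
    intro s hs
    rw [hq, linP_eval]
    apply hp
    · intro i; by_cases h : i = j <;> simp [h, hx, hs]
      exact add_nonneg (hx j) hs
    · obtain ⟨i, hi⟩ := hx'
      refine ⟨i, ?_⟩
      by_cases h : i = j
      · subst h; simp; linarith
      · simp [h, hi]
  have hd0 : q.derivative.eval 0 = 0 := by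
    rw [hq, linP_derivative, linP_eval]; simpa using h0
  by_cases hdeg : 0 < q.degree
  · have h1 := Polynomial.rootSet_derivative_subset_convexHull_rootSet hdeg
    have hq' : q.derivative ≠ 0 := by
      intro h
      have := Polynomial.natDegree_eq_zero_of_derivative_eq_zero h
      rw [Polynomial.natDegree_eq_zero_iff_degree_le_zero] at this
      exact absurd hdeg (not_lt.mpr this)
    have h2 : (0:ℂ) ∈ convexHull ℝ (q.rootSet ℂ) := by
      apply h1
      rw [Polynomial.mem_rootSet]
      exact ⟨hq', by simpa using hd0⟩
    have h3 : convexHull ℝ (q.rootSet ℂ) ⊆ {z : ℂ | z.im < 0} := by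
      apply convexHull_min
      · intro z hz
        rw [Polynomial.mem_rootSet] at hz
        by_contra hc
        exact hroot z (not_lt.mp hc) (by simpa using hz.2)
      · exact convex_halfSpace_im_lt 0
    have := h3 h2
    simp at this
  · have hc : ∀ s, q.eval s = MvPolynomial.aeval x p := by
      intro s
      rw [Polynomial.eq_C_of_degree_le_zero (not_lt.mp hdeg), Polynomial.eval_C,
        Polynomial.coeff_zero_eq_eval_zero, hq, linP_eval]
      simp
    have hw : ∀ w : ℂ, w ≠ 0 →
        MvPolynomial.aeval (fun i => w * x i + if i = j then 1 else 0) p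
          = w ^ (m+1) * MvPolynomial.aeval x p := by
      intro w hw
      rw [← hc (1 / w), hq, linP_eval, ← homog_smul hh]
      congr 2
      funext i
      by_cases h : i = j <;> simp [h, mul_add, hw]
    have hcont : Continuous fun w : ℂ =>
        MvPolynomial.aeval (fun i => w * x i + if i = j then 1 else 0) p
          - w ^ (m+1) * MvPolynomial.aeval x p := by
      simp only [MvPolynomial.aeval_def, MvPolynomial.eval₂_eq]
      fun_prop
    have hz : (fun w : ℂ =>
        MvPolynomial.aeval (fun i => w * x i + if i = j then 1 else 0) p
          - w ^ (m+1) * MvPolynomial.aeval x p) = fun _ => 0 := by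
      apply Continuous.ext_on (dense_compl_singleton (0:ℂ)) hcont continuous_const
      intro w hw'
      simp only
      rw [hw w hw', sub_self]
    have h1 := congrFun hz 0
    simp at h1
    have h2 := homog_smul hh Complex.I (fun i => if i = j then 1 else 0)
    rw [h1, mul_zero] at h2
    refine hp _ ?_ ?_ h2
    · intro i; by_cases h : i = j <;> simp [h]
    · exact ⟨j, by simp⟩

/-- log-concavity bound -/
lemma real_rooted_bound (F : Polynomial ℝ) (hs : F.Splits) (hpos : ∀ t, 0 ≤ t → 0 < F.eval t)
    (t : ℝ) (ht : 0 ≤ t) :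
    F.eval t ≤ F.eval 0 * Real.exp (t * (F.derivative.eval 0 / F.eval 0)) := by
  have h0 := hpos 0 le_rfl
  rw [hs.eval_derivative_div_eval_of_ne_zero h0.ne']
  have hr : ∀ z ∈ F.roots, z < 0 := by
    intro z hz
    by_contra hc
    have := hpos z (not_lt.mp hc)
    rw [Polynomial.isRoot_of_mem_roots hz] at this
    exact lt_irrefl _ this
  have key : ∀ M : Multiset ℝ, (∀ z ∈ M, z < 0) →
      (M.map (t - ·)).prod ≤ (M.map (0 - ·)).prod *
        Real.exp (t * (M.map fun z ↦ 1 / (0 - z)).sum) ∧ 0 ≤ (M.map (t - ·)).prod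
        ∧ 0 < (M.map (0 - ·)).prod := by
    intro M
    induction M using Multiset.induction_on with
    | empty => simp
    | cons a M ih =>
      intro h
      obtain ⟨h1, h2, h3⟩ := ih (fun z hz => h z (Multiset.mem_cons_of_mem hz))
      have ha := h a (Multiset.mem_cons_self a M)
      simp only [Multiset.map_cons, Multiset.prod_cons, Multiset.sum_cons]
      refine ⟨?_, mul_nonneg (by linarith) h2, mul_pos (by linarith) h3⟩
      have e1 : t - a ≤ (0 - a) * Real.exp (t * (1 / (0 - a))) := by
        have := Real.add_one_le_exp (t * (1 / (0 - a)))
        have h4 : (0 - a) * (t * (1 / (0 - a)) + 1) = t - a := by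
          field_simp [ha.ne]; ring
        rw [← h4]
        exact mul_le_mul_of_nonneg_left this (by linarith)
      calc _ ≤ ((0 - a) * Real.exp (t * (1 / (0 - a)))) * ((M.map (0 - ·)).prod *
        Real.exp (t * (M.map fun z ↦ 1 / (0 - z)).sum)) :=
            mul_le_mul e1 h1 h2 (by have := Real.exp_pos (t * (1 / (0 - a))); nlinarith)
        _ = _ := by rw [mul_add, Real.exp_add]; ring
  obtain ⟨h1, h2, h3⟩ := key F.roots hr
  have e0 := hs.eval_eq_prod_roots 0
  have hl : 0 < F.leadingCoeff := by
    rw [e0] at h0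
    exact (pos_iff_pos_of_mul_pos h0).mpr h3
  rw [hs.eval_eq_prod_roots t, e0, mul_assoc]
  exact mul_le_mul_of_nonneg_left h1 hl.le

lemma linP_map {ι : Type} [DecidableEq ι] (x : ι → ℝ) (j : ι) (p : MvPolynomial ι ℝ) :
    (linP x j p).map (algebraMap ℝ ℂ) = linP (fun i => (x i : ℂ)) j p := by
  unfold linP
  induction p using MvPolynomial.induction_on with
  | C a => simp [IsScalarTower.algebraMap_apply ℝ ℂ (Polynomial ℂ)]
  | add p q hp hq => simp [hp, hq]
  | mul_X p i hp =>
    rw [map_mul, Polynomial.map_mul, hp, map_mul]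
    congr 1
    by_cases h : i = j <;> simp [h]

lemma StableP.splits {ι : Type} [DecidableEq ι] {p : MvPolynomial ι ℝ} (hp : StableP p) (x : ι → ℝ) (j : ι) :
    (linP x j p).Splits := by
  apply Polynomial.Splits.of_splits_map (algebraMap ℝ ℂ) (IsAlgClosed.splits _)
  intro a ha
  rw [linP_map] at ha
  have key : ∀ b : ℂ, 0 < b.im → (linP (fun i => (x i : ℂ)) j p).eval b ≠ 0 := by
    intro b hb
    rw [linP_eval]
    apply hp
    · intro i; by_cases h : i = j <;> simp [h, hb.le]
    · exact ⟨j, by simp [hb]⟩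
  have hr : (linP (fun i => (x i : ℂ)) j p).eval a = 0 := Polynomial.isRoot_of_mem_roots ha
  have hr2 : (linP (fun i => (x i : ℂ)) j p).eval (starRingEnd ℂ a) = 0 := by
    rw [← linP_map] at hr ⊢
    rw [Polynomial.eval_map_algebraMap] at hr ⊢
    rw [Polynomial.aeval_conj, hr, map_zero]
  have h1 : ¬ 0 < a.im := fun h => key a h hr
  have h2 : ¬ 0 < (starRingEnd ℂ a).im := fun h => key _ h hr2
  rw [Complex.conj_im] at h2
  have : a.im = 0 := by linarith
  exact ⟨a.re, by apply Complex.ext <;> simp [this]⟩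


lemma cap_step {ι : Type} [DecidableEq ι] [Fintype ι] {p : MvPolynomial ι ℝ} (hp : StableP p) (S : Finset ι) (j : ι)
    (hj : j ∉ S) (c : ℝ) (hc : 0 < c)
    (h : ∀ x : ι → ℝ, (∀ i ∈ S, x i = 0) → (∀ i, i ∉ S → 0 < x i) →
      c * ∏ i ∈ Sᶜ, x i ≤ MvPolynomial.aeval x p)
    (x : ι → ℝ) (hx0 : ∀ i ∈ insert j S, x i = 0) (hx1 : ∀ i, i ∉ insert j S → 0 < x i) :
    c * Real.exp (-1) * ∏ i ∈ (insert j S)ᶜ, x i ≤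
      MvPolynomial.aeval x (MvPolynomial.pderiv j p) := by
  set F := linP x j p with hF
  set X := ∏ i ∈ (insert j S)ᶜ, x i with hX
  have hXpos : 0 < X := Finset.prod_pos fun i hi => hx1 i (by simpa using hi)
  have hxj : x j = 0 := hx0 j (mem_insert_self _ _)
  have hF' : F.derivative.eval 0 = MvPolynomial.aeval x (MvPolynomial.pderiv j p) := by
    rw [hF, linP_derivative, linP_eval]; simp
  have hFt : ∀ t, 0 < t → c * t * X ≤ F.eval t := by
    intro t ht
    rw [hF, linP_eval]
    have := h (fun i => x i + if i = j then t else 0) ?_ ?_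
    · have e : (Sᶜ : Finset ι) = insert j (insert j S)ᶜ := by
        ext i; by_cases hi : i = j <;> simp [hi, hj]
      rw [e, Finset.prod_insert (by simp)] at this
      simp only [hxj, if_true, zero_add] at this
      have e2 : ∏ i ∈ (insert j S)ᶜ, (x i + if i = j then t else 0) = X := by
        apply Finset.prod_congr rfl
        intro i hi
        have : i ≠ j := by rintro rfl; simp at hi
        simp [this]
      rw [e2] at this
      linarith
    · intro i hi
      have : i ≠ j := by rintro rfl; exact hj hi
      simp [this, hx0 i (mem_insert_of_mem hi)]
    · intro i hi
      by_cases hij : i = j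
      · subst hij; simp [hxj, ht]
      · simp [hij]; exact hx1 i (by simp [hij, hi])
  rw [← hF']
  have he : Real.exp (-1) ≤ 1 := by rw [Real.exp_le_one_iff]; norm_num
  by_cases h0 : 0 < F.eval 0
  · have hpos : ∀ t, 0 ≤ t → 0 < F.eval t := by
      intro t ht
      rcases ht.eq_or_lt with h1 | h1
      · rw [← h1]; exact h0
      · exact lt_of_lt_of_le (by positivity) (hFt t h1)
    have hb := real_rooted_bound F (hp.splits x j) hpos
    have hd : 0 < F.derivative.eval 0 := by
      by_contra hcon
      have hcon := not_lt.mp hcon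
      set t := (F.eval 0 + 1) / (c * X) with ht
      have htpos : 0 < t := by positivity
      have h1 := hFt t htpos
      have h2 := hb t htpos.le
      have h3 : Real.exp (t * (F.derivative.eval 0 / F.eval 0)) ≤ 1 := by
        rw [Real.exp_le_one_iff]
        exact mul_nonpos_of_nonneg_of_nonpos htpos.le (div_nonpos_of_nonpos_of_nonneg hcon h0.le)
      have h4 : c * t * X = F.eval 0 + 1 := by rw [ht]; field_simp
      nlinarith
    set t := F.eval 0 / F.derivative.eval 0 with ht
    have htpos : 0 < t := by positivity
    have h1 := hFt t htpos
    have h2 := hb t htpos.le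
    have h3 : t * (F.derivative.eval 0 / F.eval 0) = 1 := by rw [ht]; field_simp
    rw [h3] at h2
    have h4 : F.eval 0 = t * F.derivative.eval 0 := by rw [ht]; field_simp
    have h5 : c * X * t ≤ (F.derivative.eval 0 * Real.exp 1) * t := by
      calc c * X * t = c * t * X := by ring
        _ ≤ _ := h1.trans h2
        _ = _ := by rw [h4]; ring
    have h6 := le_of_mul_le_mul_right h5 htpos
    rw [Real.exp_neg]
    have := Real.exp_pos 1
    calc c * (Real.exp 1)⁻¹ * X = c * X / Real.exp 1 := by field_simp
      _ ≤ _ := by rw [div_le_iff₀ this]; exact h6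
  · have hder := (F.hasDerivAt 0)
    rw [hasDerivAt_iff_tendsto_slope_zero] at hder
    have hder2 := hder.mono_left (nhdsWithin_mono (0:ℝ) (s := Set.Ioi 0) (t := {0}ᶜ) (by intro y hy; simpa using (ne_of_gt hy)))
    have : c * X ≤ F.derivative.eval 0 := by
      refine ge_of_tendsto hder2 ?_
      filter_upwards [self_mem_nhdsWithin] with t ht
      have ht : 0 < t := ht
      have := hFt t ht
      simp only [zero_add, smul_eq_mul]
      rw [inv_mul_eq_div, le_div_iff₀ ht]
      have := not_lt.mp h0
      linarith
    nlinarith [mul_pos hc hXpos]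

def prodForm {n : ℕ} (a : Fin n → Fin n → ℝ) : MvPolynomial (Fin n) ℝ :=
  ∏ i, ∑ j, MvPolynomial.C (a i j) * MvPolynomial.X j

lemma cap_all {n : ℕ} (p : MvPolynomial (Fin n) ℝ) (hp : StableP p) (hh : p.IsHomogeneous n)
    (h : ∀ x : Fin n → ℝ, (∀ i, 0 < x i) → ∏ i, x i ≤ MvPolynomial.aeval x p)
    (S : Finset (Fin n)) : ∃ q : MvPolynomial (Fin n) ℝ, StableP q ∧ q.IsHomogeneous (n - S.card) ∧
      (∀ x : Fin n → ℝ, (∀ i ∈ S, x i = 0) → (∀ i, i ∉ S → 0 < x i) →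
        Real.exp (-1) ^ S.card * ∏ i ∈ Sᶜ, x i ≤ MvPolynomial.aeval x q) ∧
      MvPolynomial.coeff (∑ i ∈ Sᶜ, Finsupp.single i 1) q =
        MvPolynomial.coeff (∑ i, Finsupp.single i 1) p := by
  induction S using Finset.induction_on with
  | empty => exact ⟨p, hp, by simpa using hh, by simpa using h, by simp⟩
  | insert j S hj ih =>
    obtain ⟨q, h1, h2, h3, h4⟩ := ih
    have hcard : S.card < n := by
      have := Finset.card_lt_univ_of_notMem hj; simpa using this
    refine ⟨MvPolynomial.pderiv j q, ?_, ?_, ?_, ?_⟩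
    · apply h1.pderiv (m := n - S.card - 1)
      convert h2 using 1; omega
    · rw [card_insert_of_notMem hj]
      exact h2.pderiv
    · intro x hx0 hx1
      rw [card_insert_of_notMem hj, pow_succ]
      exact cap_step h1 S j hj _ (by positivity) h3 x hx0 hx1
    · rw [MvPolynomial.coeff_pderiv, ← h4]
      have e : (Sᶜ : Finset (Fin n)) = insert j (insert j S)ᶜ := by
        ext i; by_cases hi : i = j <;> simp [hi, hj]
      rw [e, Finset.sum_insert (by simp)]
      have : (∑ i ∈ (insert j S)ᶜ, Finsupp.single i 1 : Fin n →₀ ℕ) j = 0 := by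
        rw [Finsupp.finsetSum_apply]
        apply Finset.sum_eq_zero
        intro i hi
        have : i ≠ j := by rintro rfl; simp at hi
        simp [this]
      rw [this, add_comm]; simp

lemma prodForm_coeff {n : ℕ} (a : Fin n → Fin n → ℝ) :
    MvPolynomial.coeff (∑ i, Finsupp.single i 1) (prodForm a) =
      ∑ σ : Equiv.Perm (Fin n), ∏ i, a i (σ i) := by
  unfold prodForm
  rw [Finset.prod_univ_sum, MvPolynomial.coeff_sum]
  have e1 : ∀ f : Fin n → Fin n, MvPolynomial.coeff (∑ i, Finsupp.single i 1)
      (∏ i, MvPolynomial.C (a i (f i)) * MvPolynomial.X (f i)) =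
      if Function.Bijective f then ∏ i, a i (f i) else 0 := by
    intro f
    rw [Finset.prod_mul_distrib, ← map_prod, MvPolynomial.coeff_C_mul]
    have : (∏ i, MvPolynomial.X (f i) : MvPolynomial (Fin n) ℝ) =
        MvPolynomial.monomial (∑ i, Finsupp.single (f i) 1) 1 := by
      rw [MvPolynomial.monomial_sum_one]; rfl
    rw [this, MvPolynomial.coeff_monomial]
    have hiff : (∑ i, Finsupp.single (f i) 1 : Fin n →₀ ℕ) = ∑ i, Finsupp.single i 1 ↔
        Function.Bijective f := by
      constructor
      · intro h
        rw [← Finite.surjective_iff_bijective]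
        intro y
        have := DFunLike.congr_fun h y
        rw [Finsupp.finsetSum_apply, Finsupp.finsetSum_apply] at this
        simp only [Finsupp.single_apply, Finset.sum_ite_eq', mem_univ, if_true] at this
        by_contra hc
        push Not at hc
        rw [Finset.sum_eq_zero (fun i _ => by simp [hc i])] at this
        exact absurd this (by norm_num)
      · intro h
        exact h.sum_comp (fun i => (Finsupp.single i 1 : Fin n →₀ ℕ))
    by_cases hb : Function.Bijective f
    · rw [if_pos hb, if_pos (hiff.mpr hb), mul_one]
    · rw [if_neg hb, if_neg (fun h => hb (hiff.mp h)), mul_zero]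
  rw [Fintype.piFinset_univ, Finset.sum_congr rfl (fun f _ => e1 f), ← Finset.sum_filter]
  symm
  refine Finset.sum_bij (fun σ _ => (σ : Fin n → Fin n)) ?_ ?_ ?_ ?_
  · intro σ _; exact mem_filter.mpr ⟨mem_univ _, σ.bijective⟩
  · intro σ _ τ _ h; exact DFunLike.coe_injective h
  · intro f hf
    exact ⟨Equiv.ofBijective f (mem_filter.mp hf).2, mem_univ _, rfl⟩
  · intro σ _; rfl

lemma vdw_pos {n : ℕ} (a : Fin n → Fin n → ℝ) (hpos : ∀ i j, 0 < a i j)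
    (hr : ∀ i, ∑ j, a i j = 1) (hc : ∀ j, ∑ i, a i j = 1) :
    Real.exp (-1) ^ n ≤ ∑ σ : Equiv.Perm (Fin n), ∏ i, a i (σ i) := by
  have hst : StableP (prodForm a) := by
    intro x hx ⟨j, hj⟩
    unfold prodForm
    rw [map_prod]
    apply Finset.prod_ne_zero_iff.mpr
    intro i _ h
    have := congrArg Complex.im h
    simp only [map_sum, map_mul, MvPolynomial.aeval_C, MvPolynomial.aeval_X, Complex.im_sum,
      Complex.coe_algebraMap, Complex.im_ofReal_mul, Complex.zero_im] at this
    have hlt : 0 < ∑ k, a i k * (x k).im :=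
      Finset.sum_pos' (fun k _ => mul_nonneg (hpos i k).le (hx k)) ⟨j, mem_univ _, mul_pos (hpos i j) hj⟩
    linarith
  have hhom : (prodForm a).IsHomogeneous n := by
    unfold prodForm
    have := MvPolynomial.IsHomogeneous.prod (univ : Finset (Fin n))
      (fun i => ∑ j, MvPolynomial.C (a i j) * MvPolynomial.X (R := ℝ) j) (fun _ => 1) ?_
    · simpa using this
    · intro i _
      apply MvPolynomial.IsHomogeneous.sum
      intro j _
      simpa using (MvPolynomial.isHomogeneous_C (Fin n) (a i j)).mul (MvPolynomial.isHomogeneous_X ℝ j)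
  have hge : ∀ x : Fin n → ℝ, (∀ i, 0 < x i) → ∏ i, x i ≤ MvPolynomial.aeval x (prodForm a) := by
    intro x hx
    unfold prodForm
    simp only [map_prod, map_sum, map_mul, MvPolynomial.aeval_C, MvPolynomial.aeval_X,
      Algebra.algebraMap_self_apply]
    calc ∏ j, x j = ∏ j, x j ^ (∑ i, a i j) := by simp [hc]
      _ = ∏ j, ∏ i, x j ^ (a i j) := by
          apply Finset.prod_congr rfl; intro j _
          exact Real.rpow_sum_of_pos (hx j) _ _
      _ = ∏ i, ∏ j, x j ^ (a i j) := Finset.prod_comm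
      _ ≤ _ := by
          apply Finset.prod_le_prod
          · intro i _; exact Finset.prod_nonneg fun j _ => Real.rpow_nonneg (hx j).le _
          · intro i _
            exact Real.geom_mean_le_arith_mean_weighted univ (a i) x (fun j _ => (hpos i j).le) (hr i)
              (fun j _ => (hx j).le)
  obtain ⟨q, -, -, h3, h4⟩ := cap_all (prodForm a) hst hhom hge univ
  have h5 := h3 (fun _ => 0) (by simp) (by simp)
  rw [prodForm_coeff] at h4
  simp only [card_univ, Fintype.card_fin, compl_univ, prod_empty, mul_one, sum_empty] at h5 h4
  rw [← h4]
  convert h5 using 1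
  rw [← MvPolynomial.constantCoeff_eq, MvPolynomial.aeval_zero']
  rfl

lemma vdw {n : ℕ} (a : Fin n → Fin n → ℝ) (hpos : ∀ i j, 0 ≤ a i j)
    (hr : ∀ i, ∑ j, a i j = 1) (hc : ∀ j, ∑ i, a i j = 1) :
    Real.exp (-1) ^ n ≤ ∑ σ : Equiv.Perm (Fin n), ∏ i, a i (σ i) := by
  have hcont : Continuous fun η : ℝ => ∑ σ : Equiv.Perm (Fin n), ∏ i, ((1 - η) * a i (σ i) + η / n) := by
    fun_prop
  have ht := (hcont.tendsto 0).mono_left (nhdsWithin_le_nhds (s := Set.Ioi 0))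
  simp only [sub_zero, one_mul, zero_div, add_zero] at ht
  refine ge_of_tendsto ht ?_
  have : Set.Ioo (0:ℝ) 1 ∈ nhdsWithin (0:ℝ) (Set.Ioi 0) := Ioo_mem_nhdsGT (by norm_num)
  filter_upwards [this] with η hη
  by_cases hn : n = 0
  · subst hn; simp
  have hn' : (0:ℝ) < n := by positivity
  apply vdw_pos (fun i j => (1 - η) * a i j + η / n)
  · intro i j
    have h1 : 0 ≤ (1 - η) * a i j := mul_nonneg (by linarith [hη.2]) (hpos i j)
    have h2 : 0 < η / n := div_pos hη.1 hn'
    linarith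
  · intro i
    rw [sum_add_distrib, ← mul_sum, hr]; simp; field_simp; ring
  · intro i
    rw [sum_add_distrib, ← mul_sum, hc]; simp; field_simp; ring

/-- lower bound for number of perfect matchings of a regular bipartite graph -/
lemma match_lower {n r : ℕ} (R : Fin n → Fin n → Prop)
    (hr : ∀ i, (univ.filter fun j => R i j).card = r) (hc : ∀ j, (univ.filter fun i => R i j).card = r) :
    ((r : ℝ) * Real.exp (-1)) ^ n ≤
      ((univ.filter fun σ : Equiv.Perm (Fin n) => ∀ i, R i (σ i)).card : ℝ) := by
  by_cases hr0 : r = 0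
  · subst hr0
    rcases Nat.eq_zero_or_pos n with hn | hn
    · subst hn; simp
    · rw [Nat.cast_zero, zero_mul, zero_pow hn.ne']; positivity
  have hr' : (0:ℝ) < r := by positivity
  have := vdw (fun i j => if R i j then 1 / (r:ℝ) else 0) ?_ ?_ ?_
  · have e : ∀ σ : Equiv.Perm (Fin n), (∏ i, if R i (σ i) then 1 / (r:ℝ) else 0) =
        if ∀ i, R i (σ i) then (1 / (r:ℝ)) ^ n else 0 := by
      intro σ
      rw [Finset.prod_ite_zero]; simp
    simp only [e] at this
    rw [← Finset.sum_filter, Finset.sum_const, nsmul_eq_mul] at this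
    rw [mul_pow]
    calc (r:ℝ) ^ n * Real.exp (-1) ^ n ≤ (r:ℝ) ^ n * (_ * (1 / (r:ℝ)) ^ n) :=
          mul_le_mul_of_nonneg_left this (by positivity)
      _ = _ := by rw [one_div, inv_pow]; field_simp
  · intro i j; split_ifs <;> positivity
  · intro i
    rw [← Finset.sum_filter, Finset.sum_const, hr]; simp; field_simp
  · intro i
    rw [← Finset.sum_filter, Finset.sum_const, hc]; simp; field_simp


def gB (r : ℕ) : ℝ := Real.log (r.factorial) / r

lemma gB_rec (r : ℕ) (hr : 1 ≤ r) :
    Real.log r + ((r:ℝ) - 1) * gB (r - 1) = r * gB r := by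
  obtain ⟨s, rfl⟩ : ∃ s, r = s + 1 := ⟨r - 1, by omega⟩
  unfold gB
  simp only [Nat.add_sub_cancel]
  have h1 : ((s + 1 : ℕ) : ℝ) - 1 = s := by push_cast; ring
  rw [h1, mul_div_cancel₀ _ (by positivity : ((s+1 : ℕ):ℝ) ≠ 0)]
  rw [Nat.factorial_succ]
  push_cast
  rw [Real.log_mul (by positivity) (by positivity)]
  by_cases hs : s = 0
  · subst hs; simp
  · rw [mul_div_cancel₀ _ (by positivity : (s:ℝ) ≠ 0)]

lemma log_sum_ineq {β : Type} (B : Finset β) (t : β → ℝ) (ht : ∀ b ∈ B, 0 ≤ t b)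
    (hT : 0 < ∑ b ∈ B, t b) :
    (∑ b ∈ B, t b) * Real.log (∑ b ∈ B, t b) ≤
      (∑ b ∈ B, t b) * Real.log B.card + ∑ b ∈ B, t b * Real.log (t b) := by
  have hB : B.Nonempty := by
    rw [Finset.nonempty_iff_ne_empty]; rintro rfl; simp at hT
  have hr : (0:ℝ) < B.card := by exact_mod_cast hB.card_pos
  have := Real.convexOn_mul_log.map_sum_le (t := B) (w := fun _ => 1 / (B.card:ℝ)) (p := t)
    (fun _ _ => by positivity) (by simp; field_simp) (fun b hb => ht b hb)
  simp only [smul_eq_mul, ← Finset.mul_sum] at this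
  rw [one_div, inv_mul_eq_div, inv_mul_eq_div, Real.log_div hT.ne' hr.ne'] at this
  rw [div_mul_eq_mul_div, div_le_div_iff_of_pos_right hr] at this
  linarith

lemma minor_le {α β : Type} [Fintype α] [Fintype β] (R : α → β → Prop) (a : α) (b : β) :
    ((univ.filter fun e : α ≃ β => ∀ a, R a (e a)).filter fun e => e a = b).card ≤
    Nat.card {e' : {x // x ≠ a} ≃ {y // y ≠ b} // ∀ x, R x.1 (e' x).1} := by
  rw [Nat.card_eq_fintype_card, Fintype.card_subtype]
  by_cases hex : ∃ e : α ≃ β, e a = b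
  swap
  · push Not at hex
    rw [Finset.filter_false_of_mem (fun e _ => hex e)]; simp
  obtain ⟨e, he⟩ := hex
  apply Finset.card_le_card_of_injOn
    (fun f : α ≃ β => if h : f a = b then
      (f.subtypeEquiv (fun x => by rw [← h]; simp) : {x // x ≠ a} ≃ {y // y ≠ b})
      else e.subtypeEquiv (fun x => by rw [← he]; simp))
  · intro f hf
    have hf := mem_filter.mp (Finset.mem_coe.mp hf)
    have h1 := (mem_filter.mp hf.1).2
    simp only [hf.2, dite_true]
    simp [h1]
  · intro f hf f' hf' hff
    have hf := mem_filter.mp (Finset.mem_coe.mp hf)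
    have hf' := mem_filter.mp (Finset.mem_coe.mp hf')
    simp only [hf.2, hf'.2, dite_true] at hff
    ext x
    by_cases hx : x = a
    · rw [hx, hf.2, hf'.2]
    · have := congrArg (fun k => (k ⟨x, hx⟩).1) hff
      simpa using this

lemma bregman_aux : ∀ n : ℕ, ∀ (α β : Type) [Fintype α] [Fintype β], Fintype.card α = n →
    ∀ R : α → β → Prop,
    (Nat.card {e : α ≃ β // ∀ a, R a (e a)} : ℝ) ≤
      Real.exp (∑ a, gB (univ.filter fun b => R a b).card) := by
  intro n
  induction n with
  | zero =>
    intro α β _ _ hα R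
    have := Fintype.card_eq_zero_iff.mp hα
    rw [Finset.univ_eq_empty (α := α), Finset.sum_empty, Real.exp_zero]
    rw [Nat.card_eq_fintype_card, Fintype.card_subtype]
    have : (univ.filter fun e : α ≃ β => ∀ a, R a (e a)).card ≤ 1 := by
      apply Finset.card_le_one.mpr
      intro a _ b _
      ext x; exact isEmptyElim x
    exact_mod_cast this
  | succ n ih =>
    intro α β _ _ hα R
    rw [Nat.card_eq_fintype_card, Fintype.card_subtype]
    set S := univ.filter fun e : α ≃ β => ∀ a, R a (e a) with hS
    set F : α → Finset β := fun a => univ.filter fun b => R a b with hF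
    rcases Nat.eq_zero_or_pos S.card with hN | hN
    · rw [hN]; simp; positivity
    obtain ⟨e0, he0⟩ := Finset.card_pos.mp hN
    have hβ : Fintype.card β = n + 1 := by rw [← hα]; exact (Fintype.card_congr e0).symm
    have hNr : (0:ℝ) < S.card := by exact_mod_cast hN
    set M : α → β → ℕ := fun a b => (S.filter fun e => e a = b).card with hM
    set g' : α → β → ℝ := fun a b => gB ((F a).erase b).card with hg'
    have hsum : ∀ a, (S.card : ℝ) = ∑ b ∈ F a, (M a b : ℝ) := by
      intro a
      have := Finset.card_eq_sum_card_fiberwise (f := fun e : α ≃ β => e a) (s := S) (t := F a) ?_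
      · exact_mod_cast this
      · intro e he
        have he : e ∈ S := he
        rw [hS, mem_filter] at he
        show e a ∈ F a
        simp [hF, he.2 a]
    have h1 : ∀ a, (S.card : ℝ) * Real.log S.card ≤ S.card * Real.log (F a).card +
        ∑ e ∈ S, Real.log (M a (e a)) := by
      intro a
      have := log_sum_ineq (F a) (fun b => (M a b : ℝ)) (fun _ _ => by positivity)
        (by rw [← hsum a]; exact hNr)
      rw [← hsum a] at this
      refine this.trans (le_of_eq ?_)
      congr 1
      have hmaps : ∀ e ∈ S, e a ∈ F a := by
        intro e he
        rw [hS, mem_filter] at he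
        simp [hF, he.2 a]
      rw [← Finset.sum_fiberwise_of_maps_to hmaps]
      apply Finset.sum_congr rfl
      intro b hb
      rw [Finset.sum_congr rfl (g := fun _ => Real.log (M a b))]
      · rw [Finset.sum_const, nsmul_eq_mul]
      · intro e he
        rw [(mem_filter.mp he).2]
    have h2 : ∀ a, ∀ e ∈ S, Real.log (M a (e a)) ≤ ∑ a', g' a' (e a) - g' a (e a) := by
      intro a e he
      have hpos : 0 < M a (e a) := Finset.card_pos.mpr ⟨e, by simp [he]⟩
      rw [Real.log_le_iff_le_exp (by exact_mod_cast hpos)]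
      have hcard : Fintype.card {x // x ≠ a} = n := by
        rw [Fintype.card_subtype_compl, hα]; simp
      have := ih {x // x ≠ a} {y // y ≠ e a} hcard (fun x y => R x.1 y.1)
      have hle := minor_le R a (e a)
      refine le_trans (Nat.cast_le.mpr hle) (le_trans this (le_of_eq ?_))
      congr 1
      rw [← Finset.sum_erase_eq_sub (mem_univ a)]
      rw [Finset.sum_subtype (univ.erase a) (p := fun x => x ≠ a) (by simp) (fun a' => g' a' (e a))]
      apply Finset.sum_congr rfl
      intro x _
      simp only [hg']
      congr 1
      refine Finset.card_bij (fun y _ => y.1) ?_ ?_ ?_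
      · intro y hy; simpa [hF, y.2] using hy
      · intro y _ y' _ h; exact Subtype.ext h
      · intro y hy
        simp [hF] at hy
        exact ⟨⟨y, hy.1⟩, by simpa using hy.2, rfl⟩
    have hr1 : ∀ a, ∀ e ∈ S, e a ∈ F a := by
      intro a e he
      rw [hS, mem_filter] at he
      simp [hF, he.2 a]
    have hr : ∀ a, 1 ≤ (F a).card := fun a => Finset.card_pos.mpr ⟨e0 a, hr1 a e0 he0⟩
    have h3 : ∀ a, ∀ e ∈ S, ∑ b, g' a b - g' a (e a) =
        (((F a).card : ℝ) - 1) * gB ((F a).card - 1) + ((n:ℝ) + 1 - (F a).card) * gB (F a).card := by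
      intro a e he
      have e1 : g' a (e a) = gB ((F a).card - 1) := by
        simp only [hg']; rw [card_erase_of_mem (hr1 a e he)]
      have e2 : ∑ b, g' a b = (F a).card * gB ((F a).card - 1) +
          ((n:ℝ) + 1 - (F a).card) * gB (F a).card := by
        rw [← Finset.sum_add_sum_compl (F a)]
        congr 1
        · rw [Finset.sum_congr rfl (g := fun _ => gB ((F a).card - 1)), Finset.sum_const, nsmul_eq_mul]
          intro b hb
          simp only [hg']; rw [card_erase_of_mem hb]
        · rw [Finset.sum_congr rfl (g := fun _ => gB (F a).card), Finset.sum_const, nsmul_eq_mul]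
          · rw [Finset.card_compl, hβ, Nat.cast_sub]
            · push_cast; rfl
            · rw [← hβ]; exact Finset.card_le_univ _
          · intro b hb
            simp only [hg']; rw [erase_eq_of_notMem (by simpa using hb)]
      rw [e1, e2]; ring
    have h4 : ((n:ℝ) + 1) * (S.card * Real.log S.card) ≤
        ((n:ℝ) + 1) * (S.card * ∑ a, gB (F a).card) := by
      calc ((n:ℝ) + 1) * (S.card * Real.log S.card) = ∑ a : α, (S.card : ℝ) * Real.log S.card := by
            rw [Finset.sum_const, card_univ, hα, nsmul_eq_mul]; push_cast; ring
        _ ≤ ∑ a : α, (S.card * Real.log (F a).card +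
              ∑ e ∈ S, Real.log (M a (e a))) := Finset.sum_le_sum fun a _ => h1 a
        _ = S.card * ∑ a, Real.log (F a).card + ∑ e ∈ S, ∑ a, Real.log (M a (e a)) := by
            rw [sum_add_distrib, ← mul_sum, Finset.sum_comm]
        _ ≤ S.card * ∑ a, Real.log (F a).card + ∑ e ∈ S, ∑ a,
              ((((F a).card : ℝ) - 1) * gB ((F a).card - 1) +
                ((n:ℝ) + 1 - (F a).card) * gB (F a).card) := by
            refine add_le_add_right (Finset.sum_le_sum fun e he => ?_) _
            calc ∑ a, Real.log (M a (e a)) ≤ ∑ a, (∑ a', g' a' (e a) - g' a (e a)) :=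
                  Finset.sum_le_sum fun a _ => h2 a e he
              _ = ∑ a', (∑ b, g' a' b - g' a' (e a')) := by
                  rw [sum_sub_distrib, sum_sub_distrib, Finset.sum_comm]
                  congr 1
                  apply Finset.sum_congr rfl
                  intro a' _
                  exact Equiv.sum_comp e (fun b => g' a' b)
              _ = _ := Finset.sum_congr rfl fun a _ => h3 a e he
        _ = S.card * ∑ a, (Real.log (F a).card + ((((F a).card : ℝ) - 1) * gB ((F a).card - 1) +
                ((n:ℝ) + 1 - (F a).card) * gB (F a).card)) := by
            rw [Finset.sum_const, nsmul_eq_mul, ← mul_add, ← sum_add_distrib]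
        _ = S.card * ∑ a, ((n:ℝ) + 1) * gB (F a).card := by
            congr 1
            apply Finset.sum_congr rfl
            intro a _
            have := gB_rec _ (hr a)
            linarith
        _ = _ := by rw [← mul_sum]; ring
    have h5 := le_of_mul_le_mul_left h4 (by positivity)
    have h6 := le_of_mul_le_mul_left h5 hNr
    rwa [Real.log_le_iff_le_exp hNr] at h6

lemma match_upper {n r : ℕ} (R : Fin n → Fin n → Prop)
    (hr : ∀ i, (univ.filter fun j => R i j).card = r) :
    ((univ.filter fun σ : Equiv.Perm (Fin n) => ∀ i, R i (σ i)).card : ℝ) ≤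
      Real.exp (n * gB r) := by
  have := bregman_aux n (Fin n) (Fin n) (by simp) R
  rw [Nat.card_eq_fintype_card, Fintype.card_subtype] at this
  simp only [hr, Finset.sum_const, card_univ, Fintype.card_fin, nsmul_eq_mul] at this
  convert this using 4


def WS {n : ℕ} (S : Finset (Fin n)) : Finset (Fin n → Equiv.Perm (Fin n)) :=
  univ.filter fun R => (∀ i, i ∉ S → R i = 1) ∧ ∀ i ∈ S, ∀ j ∈ S, i ≠ j → ∀ x, R i x ≠ R j x

def XS {n : ℕ} (S : Finset (Fin n)) (R : Fin n → Equiv.Perm (Fin n)) :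
    Finset (Equiv.Perm (Fin n)) :=
  univ.filter fun σ => ∀ x, ∀ j ∈ S, R j x ≠ σ x

lemma mem_WS {n : ℕ} {S : Finset (Fin n)} {R : Fin n → Equiv.Perm (Fin n)} :
    R ∈ WS S ↔ (∀ i, i ∉ S → R i = 1) ∧ ∀ i ∈ S, ∀ j ∈ S, i ≠ j → ∀ x, R i x ≠ R j x := by
  simp [WS]

lemma WS_row {n : ℕ} {S : Finset (Fin n)} {R : Fin n → Equiv.Perm (Fin n)} (h : R ∈ WS S)
    (x : Fin n) : (univ.filter fun y => ∀ j ∈ S, R j x ≠ y).card = n - S.card := by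
  have e : (univ.filter fun y => ∀ j ∈ S, R j x ≠ y) = (S.image fun j => R j x)ᶜ := by
    ext y; simp
  rw [e, card_compl, Fintype.card_fin, card_image_of_injOn]
  intro i hi j hj hij
  by_contra hne
  exact (mem_WS.mp h).2 i hi j hj hne x hij

lemma WS_col {n : ℕ} {S : Finset (Fin n)} {R : Fin n → Equiv.Perm (Fin n)} (h : R ∈ WS S)
    (y : Fin n) : (univ.filter fun x => ∀ j ∈ S, R j x ≠ y).card = n - S.card := by
  have e : (univ.filter fun x => ∀ j ∈ S, R j x ≠ y) = (S.image fun j => (R j).symm y)ᶜ := by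
    ext x
    simp only [mem_filter, mem_univ, true_and, mem_compl, mem_image, not_exists, not_and]
    refine forall₂_congr fun j _ => not_congr ?_
    rw [Equiv.symm_apply_eq, eq_comm]
  rw [e, card_compl, Fintype.card_fin, card_image_of_injOn]
  intro i hi j hj hij
  by_contra hne
  refine (mem_WS.mp h).2 i hi j hj hne ((R i).symm y) ?_
  have hij : (R i).symm y = (R j).symm y := hij
  rw [Equiv.apply_symm_apply, hij, Equiv.apply_symm_apply]

lemma XS_lower {n : ℕ} {S : Finset (Fin n)} {R : Fin n → Equiv.Perm (Fin n)} (h : R ∈ WS S) :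
    (((n - S.card : ℕ) : ℝ) * Real.exp (-1)) ^ n ≤ ((XS S R).card : ℝ) := by
  have := match_lower (r := n - S.card) (fun x y => ∀ j ∈ S, R j x ≠ y)
    (fun x => by convert WS_row h x) (fun x => by convert WS_col h x)
  convert this using 3
  ext σ; simp [XS]

lemma XS_upper {n : ℕ} {S : Finset (Fin n)} {R : Fin n → Equiv.Perm (Fin n)} (h : R ∈ WS S) :
    ((XS S R).card : ℝ) ≤ Real.exp (n * gB (n - S.card)) := by
  have := match_upper (r := n - S.card) (fun x y => ∀ j ∈ S, R j x ≠ y)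
    (fun x => by convert WS_row h x)
  convert this using 3
  ext σ; simp [XS]

lemma WS_insert_card {n : ℕ} {S : Finset (Fin n)} {i : Fin n} (hi : i ∉ S)
    (Q : (Fin n → Equiv.Perm (Fin n)) → Prop)
    (hQ : ∀ R σ, Q (Function.update R i σ) ↔ Q R) :
    ((WS (insert i S)).filter Q).card = ∑ R ∈ (WS S).filter Q, (XS S R).card := by
  rw [← Finset.card_sigma]
  refine Finset.card_nbij' (fun R => ⟨Function.update R i 1, R i⟩)
    (fun p => Function.update p.1 i p.2) ?_ ?_ ?_ ?_
  · intro R hR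
    have hR := mem_filter.mp (mem_coe.mp hR)
    have h1 := mem_WS.mp hR.1
    have hne : ∀ j ∈ S, j ≠ i := by rintro j hj rfl; exact hi hj
    simp only [mem_coe, mem_sigma, mem_filter]
    refine ⟨⟨mem_WS.mpr ⟨?_, ?_⟩, (hQ _ _).mpr hR.2⟩, ?_⟩
    · intro j hj
      by_cases hji : j = i
      · subst hji; simp
      · rw [Function.update_of_ne hji]; exact h1.1 j (by simp [hji, hj])
    · intro j hj k hk hjk x
      rw [Function.update_of_ne (hne j hj), Function.update_of_ne (hne k hk)]
      exact h1.2 j (mem_insert_of_mem hj) k (mem_insert_of_mem hk) hjk x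
    · simp only [XS, mem_filter, mem_univ, true_and]
      intro x j hj
      rw [Function.update_of_ne (hne j hj)]
      exact h1.2 j (mem_insert_of_mem hj) i (mem_insert_self _ _) (hne j hj) x
  · rintro ⟨R, σ⟩ hR
    simp only [mem_coe, mem_sigma, mem_filter, XS, mem_univ, true_and] at hR
    obtain ⟨⟨h1, h2⟩, h3⟩ := hR
    have h1 := mem_WS.mp h1
    have hne : ∀ j ∈ S, j ≠ i := by rintro j hj rfl; exact hi hj
    simp only [mem_coe, mem_filter]
    refine ⟨mem_WS.mpr ⟨?_, ?_⟩, (hQ _ _).mpr h2⟩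
    · intro j hj
      simp only [mem_insert, not_or] at hj
      rw [Function.update_of_ne hj.1]; exact h1.1 j hj.2
    · intro j hj k hk hjk x
      rw [mem_insert] at hj hk
      rcases hj with rfl | hj
      · rcases hk with rfl | hk
        · exact absurd rfl hjk
        · rw [Function.update_self, Function.update_of_ne (hne k hk)]
          exact (h3 x k hk).symm
      · rcases hk with rfl | hk
        · rw [Function.update_self, Function.update_of_ne (hne j hj)]
          exact (h3 x j hj)
        · rw [Function.update_of_ne (hne j hj), Function.update_of_ne (hne k hk)]
          exact h1.2 j hj k hk hjk x
  · intro R hR; simp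
  · rintro ⟨R, σ⟩ hR
    simp only [mem_coe, mem_sigma, mem_filter] at hR
    have h1 := (mem_WS.mp hR.1.1).1 i hi
    simp only [Function.update_self, Function.update_idem]
    rw [← h1, Function.update_eq_self]

lemma WS_lower {n : ℕ} (S : Finset (Fin n)) :
    ∏ t ∈ range S.card, (((n - t : ℕ) : ℝ) * Real.exp (-1)) ^ n ≤ ((WS S).card : ℝ) := by
  induction S using Finset.induction_on with
  | empty =>
    simp only [card_empty, range_zero, prod_empty, Nat.one_le_cast]
    exact card_pos.mpr ⟨fun _ => 1, mem_WS.mpr (by simp)⟩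
  | insert i S hi ih =>
    have := WS_insert_card hi (fun _ => True) (by simp)
    simp only [filter_true] at this
    rw [this, card_insert_of_notMem hi, prod_range_succ]
    push_cast
    calc _ ≤ ((WS S).card : ℝ) * (((n - S.card : ℕ) : ℝ) * Real.exp (-1)) ^ n :=
          mul_le_mul_of_nonneg_right ih (by positivity)
      _ = ∑ R ∈ WS S, (((n - S.card : ℕ) : ℝ) * Real.exp (-1)) ^ n := by
          rw [sum_const, nsmul_eq_mul]
      _ ≤ _ := Finset.sum_le_sum fun R hR => XS_lower hR

lemma WS_upper {n : ℕ} (K : Finset (Fin n)) (Q : (Fin n → Equiv.Perm (Fin n)) → Prop)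
    (hQ : ∀ R i σ, i ∉ K → (Q (Function.update R i σ) ↔ Q R)) (T : Finset (Fin n))
    (hT : Disjoint K T) :
    (((WS (K ∪ T)).filter Q).card : ℝ) ≤ ((WS K).filter Q).card *
      Real.exp (∑ t ∈ range T.card, n * gB (n - K.card - t)) := by
  induction T using Finset.induction_on with
  | empty => simp
  | insert i T hi ih =>
    rw [disjoint_insert_right] at hT
    have hiK : i ∉ K ∪ T := by simp [hT.1, hi]
    rw [union_insert, WS_insert_card hiK Q (fun R σ => hQ R i σ hT.1),
      card_insert_of_notMem hi, sum_range_succ, Real.exp_add]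
    push_cast
    have hcard : (K ∪ T).card = K.card + T.card := card_union_of_disjoint hT.2
    calc ∑ R ∈ (WS (K ∪ T)).filter Q, ((XS (K ∪ T) R).card : ℝ) ≤
          ∑ R ∈ (WS (K ∪ T)).filter Q, Real.exp (n * gB (n - K.card - T.card)) := by
          refine Finset.sum_le_sum fun R hR => ?_
          have := XS_upper (mem_filter.mp hR).1
          rwa [hcard, ← Nat.sub_sub] at this
      _ = ((WS (K ∪ T)).filter Q).card * Real.exp (n * gB (n - K.card - T.card)) := by
          rw [sum_const, nsmul_eq_mul]
      _ ≤ _ := mul_le_mul_of_nonneg_right (ih hT.2) (Real.exp_pos _).le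
      _ = _ := by ring

lemma perm_restrict {n : ℕ} (M : Finset (Fin n)) (f : Fin n → Fin n) :
    (univ.filter fun σ : Equiv.Perm (Fin n) => ∀ j ∈ M, σ j = f j).card ≤ (n - M.card).factorial := by
  rcases Finset.eq_empty_or_nonempty (univ.filter fun σ : Equiv.Perm (Fin n) => ∀ j ∈ M, σ j = f j)
    with h | ⟨σ0, h0⟩
  · rw [h]; simp
  have h0 := (mem_filter.mp h0).2
  calc _ ≤ (univ.filter fun σ : Equiv.Perm (Fin n) => ∀ j, ¬ (j ∉ M) → σ j = j).card := by
        apply Finset.card_le_card_of_injOn (fun σ => σ0⁻¹ * σ)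
        · intro σ hσ
          have hσ := (mem_filter.mp (mem_coe.mp hσ)).2
          simp only [mem_coe, mem_filter, mem_univ, true_and, not_not]
          intro j hj
          rw [Equiv.Perm.mul_apply, hσ j hj, ← h0 j hj]; simp
        · intro σ _ τ _ h
          exact mul_left_cancel h
    _ = Fintype.card {σ : Equiv.Perm (Fin n) // ∀ j, ¬ (j ∉ M) → σ j = j} := by
        rw [Fintype.card_subtype]
    _ = Fintype.card (Equiv.Perm {j // j ∉ M}) :=
        (Fintype.card_congr (Equiv.Perm.subtypeEquivSubtypePerm (fun j => j ∉ M))).symm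
    _ = (n - M.card).factorial := by
        rw [Fintype.card_perm, Fintype.card_subtype_compl]; simp
    _ ≤ _ := le_rfl

lemma WS_base {n : ℕ} (K M : Finset (Fin n)) (ρ : Fin n → Fin n → Fin n) :
    ((WS K).filter fun R => ∀ i ∈ K, ∀ j ∈ M, R i j = ρ i j).card ≤
      (n - M.card).factorial ^ K.card := by
  calc _ ≤ (Fintype.piFinset fun i => if i ∈ K then
        (univ.filter fun σ : Equiv.Perm (Fin n) => ∀ j ∈ M, σ j = ρ i j) else {1}).card := by
        apply card_le_card
        intro R hR
        rw [mem_filter, mem_WS] at hR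
        rw [Fintype.mem_piFinset]
        intro i
        by_cases hi : i ∈ K
        · simp only [hi, if_true, mem_filter, mem_univ, true_and]; exact hR.2 i hi
        · simp [hi, hR.1.1 i hi]
    _ = ∏ i, if i ∈ K then
        (univ.filter fun σ : Equiv.Perm (Fin n) => ∀ j ∈ M, σ j = ρ i j).card else 1 := by
        rw [Fintype.card_piFinset]
        apply prod_congr rfl
        intro i _
        split_ifs <;> simp
    _ = ∏ i ∈ K, (univ.filter fun σ : Equiv.Perm (Fin n) => ∀ j ∈ M, σ j = ρ i j).card := by
        rw [Finset.prod_ite_mem]; simp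
    _ ≤ ∏ i ∈ K, (n - M.card).factorial := Finset.prod_le_prod' fun i _ => perm_restrict M (ρ i)
    _ = _ := by simp

lemma latin_card_eq {n : ℕ} (Q : (Fin n → Equiv.Perm (Fin n)) → Prop) :
    (univ.filter fun L : LatinSquare n => Q L.1).card = ((WS univ).filter Q).card := by
  refine Finset.card_bij (fun L _ => L.1) ?_ ?_ ?_
  · intro L hL
    rw [mem_filter] at hL ⊢
    exact ⟨mem_WS.mpr ⟨by simp, fun i _ j _ h x => L.2 i j h x⟩, hL.2⟩
  · intro L _ L' _ h; exact Subtype.ext h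
  · intro R hR
    rw [mem_filter, mem_WS] at hR
    exact ⟨⟨R, fun i j h x => hR.1.2 i (mem_univ _) j (mem_univ _) h x⟩, by simp [hR.2], rfl⟩

lemma latin_lower (n : ℕ) :
    ∏ t ∈ range n, (((n - t : ℕ) : ℝ) * Real.exp (-1)) ^ n ≤ (Fintype.card (LatinSquare n) : ℝ) := by
  have h := WS_lower (univ : Finset (Fin n))
  have h2 := latin_card_eq (n := n) (fun _ => True)
  simp only [filter_true, card_univ] at h2
  rw [← h2] at h
  simpa using h

lemma latin_upper {n : ℕ} (K M : Finset (Fin n)) (ρ : Fin n → Fin n → Fin n) :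
    ((univ.filter fun L : LatinSquare n => ∀ i ∈ K, ∀ j ∈ M, L.1 i j = ρ i j).card : ℝ) ≤
      ((n - M.card).factorial : ℝ) ^ K.card *
      Real.exp (∑ t ∈ range (n - K.card), n * gB (n - K.card - t)) := by
  have h2 := latin_card_eq (n := n) (fun R => ∀ i ∈ K, ∀ j ∈ M, R i j = ρ i j)
  have h := WS_upper K (fun R => ∀ i ∈ K, ∀ j ∈ M, R i j = ρ i j) ?_ Kᶜ disjoint_compl_right
  · rw [union_compl, card_compl, Fintype.card_fin] at h
    rw [← h2] at h
    have h3 : (univ.filter fun L : LatinSquare n => ∀ i ∈ K, ∀ j ∈ M, L.1 i j = ρ i j) =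
      @Finset.filter _ (fun L : LatinSquare n => ∀ i ∈ K, ∀ j ∈ M, L.1 i j = ρ i j)
        (fun _ => Classical.propDecidable _) univ := by congr
    rw [h3]
    refine h.trans (mul_le_mul_of_nonneg_right ?_ (Real.exp_pos _).le)
    have h4 := WS_base K M ρ
    have h5 : ((WS K).filter fun R => ∀ i ∈ K, ∀ j ∈ M, R i j = ρ i j) =
      @Finset.filter _ (fun R => ∀ i ∈ K, ∀ j ∈ M, R i j = ρ i j)
        (fun _ => Classical.propDecidable _) (WS K) := by congr
    rw [h5] at h4
    exact_mod_cast h4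
  · intro R i σ hi
    refine forall₂_congr fun i' hi' => ?_
    rw [Function.update_of_ne]
    rintro rfl; exact hi hi'


lemma avg_select {α : Type*} (w : α → ℝ) (k : ℕ) (S : Finset α) (hk : k ≤ S.card) :
    ∃ K ⊆ S, K.card = k ∧ (k : ℝ) * ∑ i ∈ S, w i ≤ S.card * ∑ i ∈ K, w i := by
  induction S using Finset.strongInduction with
  | H S ih =>
    rcases eq_or_lt_of_le hk with h | h
    · exact ⟨S, subset_rfl, h.symm, by rw [h]⟩
    · have hne : S.Nonempty := card_pos.mp (by omega)
      obtain ⟨x, hx, hmin⟩ := S.exists_min_image w hne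
      have hc := card_erase_of_mem hx
      obtain ⟨K, hK, hKc, hle⟩ := ih (S.erase x) (erase_ssubset hx) (by omega)
      refine ⟨K, hK.trans (erase_subset _ _), hKc, ?_⟩
      have h1 : ∑ i ∈ S, w i = w x + ∑ i ∈ S.erase x, w i := (add_sum_erase _ _ hx).symm
      have h2 : (S.card : ℝ) * w x ≤ ∑ i ∈ S, w i := by
        rw [← nsmul_eq_mul]; exact Finset.card_nsmul_le_sum _ _ _ hmin
      have hs : ((S.erase x).card : ℝ) = S.card - 1 := by
        rw [hc, Nat.cast_sub (by omega)]; simp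
      rw [hs] at hle
      have hs1 : (1 : ℝ) < S.card ∨ (S.card : ℝ) = 1 := by
        rcases (show 1 ≤ S.card by omega).lt_or_eq with h | h
        · left; exact_mod_cast h
        · right; exact_mod_cast h.symm
      rcases hs1 with hs1 | hs1
      · have h3 : (S.card - 1 : ℝ) * ∑ i ∈ S, w i ≤ S.card * ∑ i ∈ S.erase x, w i := by
          nlinarith
        have h4 : (S.card - 1 : ℝ) * (k * ∑ i ∈ S, w i) ≤ (S.card - 1 : ℝ) * (S.card * ∑ i ∈ K, w i) := by
          have hk0 : (0:ℝ) ≤ k := by positivity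
          have := mul_le_mul_of_nonneg_left h3 hk0
          have := mul_le_mul_of_nonneg_left hle (show (0:ℝ) ≤ S.card by positivity)
          nlinarith
        exact le_of_mul_le_mul_left h4 (by linarith)
      · have : S.card = 1 := by exact_mod_cast hs1
        have hk0 : k = 0 := by omega
        subst hk0
        rw [card_eq_zero.mp hKc]; simp

def eC {n : ℕ} (E : Fin n → Fin n → Fin n → Prop) (i j : Fin n) : ℕ := (univ.filter fun k => E i j k).card

lemma few_hits {n : ℕ} (K M : Finset (Fin n)) (E : Fin n → Fin n → Fin n → Prop) (h : ℕ) :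
    ((univ.filter fun L : LatinSquare n =>
      ((K ×ˢ M).filter fun p => E p.1 p.2 (L.1 p.1 p.2)).card ≤ h).card : ℝ) ≤
    2 ^ h * (((n - M.card).factorial : ℝ) ^ K.card *
      Real.exp (∑ t ∈ range (n - K.card), n * gB (n - K.card - t))) *
      ∏ p ∈ K ×ˢ M, ((n : ℝ) - (eC E p.1 p.2 : ℝ) / 2) := by
  set U := (((n - M.card).factorial : ℝ) ^ K.card *
      Real.exp (∑ t ∈ range (n - K.card), n * gB (n - K.card - t))) with hU
  let g : Fin n × Fin n → Fin n → ℝ := fun p k => if E p.1 p.2 k then 1/2 else 1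
  have hg : ∀ p k, 0 ≤ g p k := by intro p k; simp only [g]; split_ifs <;> norm_num
  let r : LatinSquare n → (↥(K ×ˢ M) → Fin n) := fun L p => L.1 p.1.1 p.1.2
  have hprod : ∀ L : LatinSquare n, ∏ p ∈ K ×ˢ M, g p (L.1 p.1 p.2) =
      (1/2 : ℝ) ^ ((K ×ˢ M).filter fun p => E p.1 p.2 (L.1 p.1 p.2)).card := by
    intro L
    simp only [g]
    rw [Finset.prod_ite]; simp
  calc _ = ∑ L ∈ (univ.filter fun L : LatinSquare n =>
      ((K ×ˢ M).filter fun p => E p.1 p.2 (L.1 p.1 p.2)).card ≤ h), (1:ℝ) := by simp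
    _ ≤ ∑ L ∈ (univ.filter fun L : LatinSquare n =>
      ((K ×ˢ M).filter fun p => E p.1 p.2 (L.1 p.1 p.2)).card ≤ h),
        2 ^ h * ∏ p ∈ K ×ˢ M, g p (L.1 p.1 p.2) := by
        refine sum_le_sum fun L hL => ?_
        rw [hprod, one_div, inv_pow, ← div_eq_mul_inv, le_div_iff₀ (by positivity), one_mul]
        exact pow_le_pow_right₀ (by norm_num) (mem_filter.mp hL).2
    _ ≤ ∑ L : LatinSquare n, 2 ^ h * ∏ p ∈ K ×ˢ M, g p (L.1 p.1 p.2) :=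
        sum_le_sum_of_subset_of_nonneg (filter_subset _ _) fun L _ _ =>
          mul_nonneg (by positivity) (prod_nonneg fun p _ => hg _ _)
    _ = 2 ^ h * ∑ L : LatinSquare n, ∏ p : ↥(K ×ˢ M), g p (r L p) := by
        rw [mul_sum]
        refine sum_congr rfl fun L _ => ?_
        rw [← Finset.prod_coe_sort]
    _ = 2 ^ h * ∑ ρ : ↥(K ×ˢ M) → Fin n, ∑ L ∈ univ.filter (fun L => r L = ρ),
          ∏ p : ↥(K ×ˢ M), g p (ρ p) := by
        congr 1
        rw [← Finset.sum_fiberwise univ r]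
        refine sum_congr rfl fun ρ _ => sum_congr rfl fun L hL => ?_
        rw [(mem_filter.mp hL).2]
    _ ≤ 2 ^ h * ∑ ρ : ↥(K ×ˢ M) → Fin n, U * ∏ p : ↥(K ×ˢ M), g p (ρ p) := by
        refine mul_le_mul_of_nonneg_left (sum_le_sum fun ρ _ => ?_) (by positivity)
        rw [sum_const, nsmul_eq_mul]
        refine mul_le_mul_of_nonneg_right ?_ (prod_nonneg fun p _ => hg _ _)
        refine le_trans ?_ (latin_upper K M
          (fun i j => if h : (i, j) ∈ K ×ˢ M then ρ ⟨(i, j), h⟩ else i))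
        have : (univ.filter fun L => r L = ρ) ⊆ (univ.filter fun L : LatinSquare n =>
          ∀ i ∈ K, ∀ j ∈ M, L.1 i j =
            (fun i j => if h : (i, j) ∈ K ×ˢ M then ρ ⟨(i, j), h⟩ else i) i j) := by
          intro L hL
          have hL := (mem_filter.mp hL).2
          rw [mem_filter]
          refine ⟨mem_univ _, fun i hi j hj => ?_⟩
          have hm : (i, j) ∈ K ×ˢ M := mem_product.mpr ⟨hi, hj⟩
          beta_reduce
          rw [dif_pos hm]
          exact congrFun hL ⟨(i, j), hm⟩
        exact_mod_cast card_le_card this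
    _ = 2 ^ h * U * ∏ p : ↥(K ×ˢ M), ∑ k, g p k := by
        rw [← mul_sum, ← mul_assoc]
        congr 1
        have := Finset.prod_univ_sum (fun _ : ↥(K ×ˢ M) => (univ : Finset (Fin n))) (fun p k => g p k)
        rw [this, Fintype.piFinset_univ]
    _ = _ := by
        congr 1
        rw [Finset.prod_coe_sort (K ×ˢ M) (fun p => ∑ k, g p k)]
        refine prod_congr rfl fun p _ => ?_
        have h1 : ∀ k, g p k = 1 - (if E p.1 p.2 k then 1/2 else 0) := by
          intro k; simp only [g]; split_ifs <;> norm_num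
        simp_rw [h1]
        rw [sum_sub_distrib, ← sum_filter, sum_const, sum_const]
        simp [eC]; ring

lemma few_hits2 {n : ℕ} (hn : 0 < n) (K M : Finset (Fin n)) (E : Fin n → Fin n → Fin n → Prop)
    (c : ℝ) (hE : c * K.card * M.card * n ≤ ∑ i ∈ K, ∑ j ∈ M, (eC E i j : ℝ)) (x : ℝ)
    (hx0 : 0 ≤ x) (hx : x ≤ c / 4 * K.card * M.card) :
    ((univ.filter fun L : LatinSquare n =>
      (((K ×ˢ M).filter fun p => E p.1 p.2 (L.1 p.1 p.2)).card : ℝ) ≤ x).card : ℝ) ≤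
    (((n - M.card).factorial : ℝ) ^ K.card *
      Real.exp (∑ t ∈ range (n - K.card), n * gB (n - K.card - t))) * 
      ((n : ℝ) ^ (K.card * M.card) * Real.exp (- (c / 4 * K.card * M.card))) := by
  have hn' : (0:ℝ) < n := by exact_mod_cast hn
  have h0 := few_hits K M E ⌊x⌋₊
  have h1 : ∏ p ∈ K ×ˢ M, ((n : ℝ) - (eC E p.1 p.2 : ℝ) / 2) ≤
      (n : ℝ) ^ (K.card * M.card) * Real.exp (- (c / 2 * K.card * M.card)) := by
    calc _ ≤ ∏ p ∈ K ×ˢ M, ((n : ℝ) * Real.exp (- (eC E p.1 p.2 : ℝ) / (2 * n))) := by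
          refine prod_le_prod (fun p _ => ?_) (fun p _ => ?_)
          · have : (eC E p.1 p.2 : ℝ) ≤ n := by
              have := card_le_univ (univ.filter fun k => E p.1 p.2 k)
              rw [Fintype.card_fin] at this
              exact_mod_cast this
            linarith
          · have := Real.add_one_le_exp (- (eC E p.1 p.2 : ℝ) / (2 * n))
            calc _ = (n:ℝ) * (- (eC E p.1 p.2 : ℝ) / (2 * n) + 1) := by field_simp; ring
              _ ≤ _ := by gcongr
      _ = (n : ℝ) ^ (K.card * M.card) *
          Real.exp (- (∑ i ∈ K, ∑ j ∈ M, (eC E i j : ℝ)) / (2 * n)) := by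
          rw [prod_mul_distrib, prod_const, card_product, ← Real.exp_sum, ← sum_product',
            ← sum_div, sum_neg_distrib]
      _ ≤ _ := by
          gcongr
          rw [div_le_iff₀ (by positivity)]
          nlinarith
  have h2 : (2:ℝ) ^ ⌊x⌋₊ ≤ Real.exp (c / 4 * K.card * M.card) := by
    calc (2:ℝ) ^ ⌊x⌋₊ ≤ (Real.exp 1) ^ ⌊x⌋₊ := by
          gcongr; have := Real.add_one_le_exp (1:ℝ); linarith
      _ = Real.exp ⌊x⌋₊ := by rw [← Real.exp_nat_mul]; simp
      _ ≤ _ := Real.exp_le_exp.mpr ((Nat.floor_le hx0).trans hx)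
  set U := (((n - M.card).factorial : ℝ) ^ K.card *
      Real.exp (∑ t ∈ range (n - K.card), n * gB (n - K.card - t))) with hU
  have hU0 : 0 ≤ U := by positivity
  calc _ = ((univ.filter fun L : LatinSquare n =>
      ((K ×ˢ M).filter fun p => E p.1 p.2 (L.1 p.1 p.2)).card ≤ ⌊x⌋₊).card : ℝ) := by
        congr 2; ext L; simp only [mem_filter, mem_univ, true_and]; rw [Nat.le_floor_iff hx0]
    _ ≤ _ := h0
    _ ≤ Real.exp (c / 4 * K.card * M.card) * U * ((n : ℝ) ^ (K.card * M.card) * Real.exp (- (c / 2 * K.card * M.card))) := by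
        refine mul_le_mul (mul_le_mul_of_nonneg_right h2 hU0) h1 (prod_nonneg fun p _ => ?_) (by positivity)
        have : (eC E p.1 p.2 : ℝ) ≤ n := by
              have := card_le_univ (univ.filter fun k => E p.1 p.2 k)
              rw [Fintype.card_fin] at this
              exact_mod_cast this
        linarith
    _ = U * ((n : ℝ) ^ (K.card * M.card) * (Real.exp (c / 4 * K.card * M.card) * Real.exp (- (c / 2 * K.card * M.card)))) := by ring
    _ = _ := by rw [← Real.exp_add]; congr 3; ring


lemma log_fact_le (r : ℕ) (hr : 1 ≤ r) :
    Real.log r.factorial ≤ r * Real.log r - r + Real.log r + 1 := by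
  induction r, hr using Nat.le_induction with
  | base => simp
  | succ r hr ih =>
    have hr0 : (0:ℝ) < r := by exact_mod_cast hr
    rw [Nat.factorial_succ]
    push_cast
    rw [Real.log_mul (by positivity) (by positivity)]
    -- log(r+1) - log r >= 1/(r+1)
    have h : Real.log r - Real.log (r+1) ≤ - (1 / ((r:ℝ)+1)) := by
      rw [← Real.log_div (by positivity) (by positivity)]
      have := Real.log_le_sub_one_of_pos (show (0:ℝ) < (r:ℝ)/(r+1) by positivity)
      calc _ ≤ _ := this
        _ = _ := by field_simp; ring
    have h2 : (r + 1 : ℝ) * (Real.log r - Real.log (r+1)) ≤ -1 := by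
      calc _ ≤ (r + 1 : ℝ) * (- (1 / ((r:ℝ)+1))) := by gcongr
        _ = -1 := by field_simp
    nlinarith

lemma gB_le (r n : ℕ) (hr : 1 ≤ r) (hrn : r ≤ n) :
    gB r ≤ (Real.log r - 1) + (1 + Real.log n) * (r : ℝ)⁻¹ := by
  have hr0 : (0:ℝ) < r := by exact_mod_cast hr
  have h1 := log_fact_le r hr
  have h2 : Real.log r ≤ Real.log n := Real.log_le_log hr0 (by exact_mod_cast hrn)
  unfold gB
  rw [div_le_iff₀ hr0]
  have : ((Real.log r - 1) + (1 + Real.log n) * (r : ℝ)⁻¹) * r = (Real.log r - 1) * r + (1 + Real.log n) := by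
    field_simp
  rw [this]; linarith

lemma sum_gB_le (n k : ℕ) (hk : k < n) :
    ∑ t ∈ range (n - k), (n:ℝ) * gB (n - k - t) ≤
      n * ∑ r ∈ range (n - k), (Real.log (r + 1 : ℕ) - 1) + n * (1 + Real.log n) ^ 2 := by
  have hln : 0 ≤ Real.log n := Real.log_natCast_nonneg n
  rw [← mul_sum]
  have e : ∑ t ∈ range (n - k), gB (n - k - t) = ∑ r ∈ range (n - k), gB (r + 1) := by
    rw [← sum_range_reflect]
    refine sum_congr rfl fun t ht => ?_
    rw [mem_range] at ht
    congr 1; omega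
  rw [e]
  have h1 : ∑ r ∈ range (n - k), gB (r + 1) ≤ ∑ r ∈ range (n - k),
      ((Real.log (r + 1 : ℕ) - 1) + (1 + Real.log n) * (((r + 1 : ℕ)) : ℝ)⁻¹) := by
    refine sum_le_sum fun r hr => ?_
    rw [mem_range] at hr
    exact gB_le (r+1) n (by omega) (by omega)
  rw [sum_add_distrib, ← mul_sum] at h1
  have h2 : ∑ r ∈ range (n - k), (((r + 1 : ℕ)) : ℝ)⁻¹ ≤ 1 + Real.log n := by
    have := harmonic_le_one_add_log (n - k)
    unfold harmonic at this
    push_cast at this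
    have h3 : Real.log ((n - k : ℕ) : ℝ) ≤ Real.log n :=
      Real.log_le_log (by exact_mod_cast (by omega : 0 < n - k)) (by exact_mod_cast (by omega))
    push_cast
    linarith
  have h3 : (1 + Real.log n) * ∑ r ∈ range (n - k), (((r + 1 : ℕ)) : ℝ)⁻¹ ≤ (1 + Real.log n) * (1 + Real.log n) := by gcongr
  have h4 := mul_le_mul_of_nonneg_left (h1.trans (add_le_add_right h3 _)) (Nat.cast_nonneg (α := ℝ) n)
  linarith

lemma latin_lower' (n : ℕ) :
    Real.exp (n * ∑ r ∈ range n, (Real.log (r + 1 : ℕ) - 1)) ≤ (Fintype.card (LatinSquare n) : ℝ) := by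
  refine le_trans (le_of_eq ?_) (latin_lower n)
  rw [mul_sum, Real.exp_sum, ← prod_range_reflect]
  refine prod_congr rfl fun t ht => ?_
  rw [mem_range] at ht
  have h1 : n - 1 - t + 1 = n - t := by omega
  have h2 : (0:ℝ) < ((n - t : ℕ) : ℝ) := by exact_mod_cast (by omega)
  rw [h1, Real.exp_nat_mul, Real.exp_sub, Real.exp_log h2, Real.exp_neg, div_eq_mul_inv]

lemma latin_pos (n : ℕ) : (0:ℝ) < Fintype.card (LatinSquare n) :=
  lt_of_lt_of_le (Real.exp_pos _) (latin_lower' n)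

lemma ratio_bound (n k m : ℕ) (hk : 2 * k ≤ n) (hm : m < n) (hk0 : 0 < k) :
    ((n - m).factorial : ℝ) ^ k * Real.exp (∑ t ∈ range (n - k), n * gB (n - k - t)) *
      (n : ℝ) ^ (k * m) ≤ 
    Real.exp (2 * k ^ 2 + k * m ^ 2 / n + 2 * n * (1 + Real.log n) ^ 2) *
      (Fintype.card (LatinSquare n) : ℝ) := by
  have hn0 : 0 < n := by omega
  have hn : (0:ℝ) < n := by exact_mod_cast hn0
  have hln : 0 ≤ Real.log n := Real.log_natCast_nonneg n
  have hnm : (0:ℝ) < (n - m : ℕ) := by exact_mod_cast (by omega)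
  have hnm' : ((n - m : ℕ) : ℝ) = n - m := Nat.cast_sub hm.le
  refine le_trans ?_ (mul_le_mul_of_nonneg_left (latin_lower' n) (Real.exp_pos _).le)
  rw [← Real.exp_add]
  have e1 : ((n - m).factorial : ℝ) ^ k = Real.exp (k * Real.log (n - m).factorial) := by
    rw [Real.exp_nat_mul, Real.exp_log (by positivity)]
  have e2 : (n : ℝ) ^ (k * m) = Real.exp ((k * m : ℕ) * Real.log n) := by
    rw [Real.exp_nat_mul, Real.exp_log (by positivity)]
  rw [e1, e2, ← Real.exp_add, ← Real.exp_add, Real.exp_le_exp]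
  have h1 := sum_gB_le n k (by omega)
  have h2 := log_fact_le (n - m) (by omega)
  have h3 : Real.log ((n - m : ℕ) : ℝ) ≤ Real.log n - m / n := by
    have := Real.log_le_sub_one_of_pos (show (0:ℝ) < ((n - m : ℕ) : ℝ) / n by positivity)
    rw [Real.log_div (by positivity) (by positivity), hnm'] at this
    rw [hnm']
    have e : ((n:ℝ) - m) / n - 1 = - (m / n) := by field_simp; ring
    linarith
  have h4 : Real.log (n - m).factorial ≤ (n - m) * Real.log n - n + m ^ 2 / n + (1 + Real.log n) := by
    have a : ((n - m : ℕ) : ℝ) * Real.log ((n - m : ℕ) : ℝ) ≤ (n - m) * (Real.log n - m / n) := by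
      rw [← hnm']; gcongr
    have b : ((n:ℝ) - m) * (Real.log n - m / n) = (n - m) * Real.log n - m + m^2/n := by
      field_simp; ring
    have d : (0:ℝ) ≤ m / n := by positivity
    rw [hnm'] at h2 h3 a
    linarith
  have h5 : (k:ℝ) * Real.log (n - m).factorial ≤ k * ((n - m) * Real.log n - n + m ^ 2 / n + (1 + Real.log n)) := by gcongr
  have h6 : ∑ r ∈ range n, (Real.log (r + 1 : ℕ) - 1) ≥ ∑ r ∈ range (n - k), (Real.log (r + 1 : ℕ) - 1)
      + k * (Real.log (n - k : ℕ) - 1) := by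
    have : n = (n - k) + k := by omega
    conv_lhs => rw [this, sum_range_add]
    gcongr
    have : (k:ℝ) * (Real.log (n - k : ℕ) - 1) = ∑ x ∈ range k, (Real.log (n - k : ℕ) - 1) := by
      rw [sum_const, card_range, nsmul_eq_mul]
    rw [this]
    refine sum_le_sum fun x _ => ?_
    gcongr
    · exact_mod_cast (by omega : 0 < n - k)
    · omega
  have hnk : ((n - k : ℕ) : ℝ) = n - k := Nat.cast_sub (by omega)
  have hk2 : (2:ℝ) * k ≤ n := by exact_mod_cast hk
  have hkp : (0:ℝ) < k := by exact_mod_cast hk0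
  have h7 : Real.log n - Real.log (n - k : ℕ) ≤ 2 * k / n := by
    rw [hnk, ← Real.log_div (by positivity) (by linarith)]
    have := Real.log_le_sub_one_of_pos (show (0:ℝ) < (n:ℝ) / (n - k) by apply div_pos <;> linarith)
    refine this.trans ?_
    have hh : (0:ℝ) < n - k := by linarith
    rw [div_sub_one hh.ne', div_le_div_iff₀ hh hn]
    nlinarith
  have h8 : (n:ℝ) * k * (Real.log n - Real.log (n - k : ℕ)) ≤ 2 * k ^ 2 := by
    calc _ ≤ (n:ℝ) * k * (2 * k / n) := by gcongr
      _ = _ := by field_simp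
  have h9 : (n:ℝ) * ∑ r ∈ range n, (Real.log (r + 1 : ℕ) - 1) ≥ n * (∑ r ∈ range (n - k), (Real.log (r + 1 : ℕ) - 1)
      + k * (Real.log (n - k : ℕ) - 1)) := by gcongr
  have h10 : (k:ℝ) * (1 + Real.log n) ≤ n * (1 + Real.log n)^2 := by
    have : (1 + Real.log n) ≤ (1 + Real.log n)^2 := by nlinarith
    have h : (k:ℝ) ≤ n := by linarith
    gcongr
  have e3 : (k:ℝ) * (m^2/n) = k * m^2/n := by ring
  rw [Nat.cast_mul, ← e3]
  generalize ∑ r ∈ range n, (Real.log (r + 1 : ℕ) - 1) = A at *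
  generalize ∑ r ∈ range (n - k), (Real.log (r + 1 : ℕ) - 1) = B at *
  generalize ∑ t ∈ range (n - k), (n:ℝ) * gB (n - k - t) = C at *
  generalize (m:ℝ)^2 / n = D at *
  linarith


lemma ev_log_small (δ : ℝ) (hδ : 0 < δ) :
    ∀ᶠ n : ℕ in Filter.atTop, 2 * (n:ℝ) * (1 + Real.log n) ^ 2 ≤ δ * (n:ℝ) ^ 2 := by
  have h1 := (Real.isLittleO_pow_log_id_atTop (n := 2)).bound (show 0 < δ / 8 by positivity)
  have h2 := tendsto_natCast_atTop_atTop (R := ℝ) |>.eventually h1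
  filter_upwards [h2, Filter.eventually_ge_atTop (⌈8 / δ⌉₊ + 1)] with n h hn
  have hn1 : 8 / δ ≤ n := by
    have := Nat.le_ceil (8/δ)
    have h' : ((⌈8/δ⌉₊ : ℕ) : ℝ) ≤ n := by exact_mod_cast (by omega)
    linarith
  rw [div_le_iff₀ hδ] at hn1
  have hn0 : (0:ℝ) ≤ n := Nat.cast_nonneg n
  simp only [id, Real.norm_eq_abs, abs_of_nonneg hn0, abs_pow, sq_abs] at h
  have h3 : (1 + Real.log n)^2 ≤ 2 + 2 * Real.log n ^ 2 := by nlinarith [sq_nonneg (1 - Real.log n)]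
  nlinarith

set_option maxHeartbeats 2000000 in
lemma large_dev (c : ℝ) (hc : 0 < c) (hc1 : c ≤ 1) :
    ∃ c3 : ℝ, 0 < c3 ∧ ∃ γ : ℝ, 0 < γ ∧ ∀ᶠ n : ℕ in Filter.atTop,
      ∀ E : Fin n → Fin n → Fin n → Prop, c * (n:ℝ) ^ 3 ≤ ∑ i, ∑ j, (eC E i j : ℝ) →
      ((univ.filter fun L : LatinSquare n =>
        ((univ.filter fun p : Fin n × Fin n => E p.1 p.2 (L.1 p.1 p.2)).card : ℝ) ≤ γ * (n:ℝ)^2).card : ℝ)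
      ≤ Real.exp (- (c3 * (n:ℝ)^2)) * Fintype.card (LatinSquare n) := by
  set q : ℝ := c / 64 * (c / 32) ^ 2 with hq
  have hq0 : 0 < q := by positivity
  refine ⟨c * q / 16, by positivity, c / 4 * q, by positivity, ?_⟩
  filter_upwards [ev_log_small (c * q / 16) (by positivity),
    Filter.eventually_ge_atTop (⌈2048 / c ^ 2⌉₊ + 1)] with n hlog hn E hE
  have hn1 : 2048 / c ^ 2 ≤ n := by
    have := Nat.le_ceil (2048 / c^2)
    have h' : ((⌈2048 / c^2⌉₊ : ℕ) : ℝ) ≤ n := by exact_mod_cast (by omega)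
    linarith
  have hn0 : 0 < n := by omega
  have hnp : (0:ℝ) < n := by exact_mod_cast hn0
  rw [div_le_iff₀ (by positivity)] at hn1
  set m := ⌊c * n / 16⌋₊ with hm
  set k := ⌊c * m / 32⌋₊ with hk
  have hm1 : (m:ℝ) ≤ c * n / 16 := Nat.floor_le (by positivity)
  have hm2 : c * n / 32 ≤ m := by
    have := Nat.lt_floor_add_one (c * n / 16)
    have h3 : (32:ℝ) ≤ c * n := by nlinarith
    rw [← hm] at this; linarith
  have hk1 : (k:ℝ) ≤ c * m / 32 := Nat.floor_le (by positivity)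
  have hk2 : c * m / 64 ≤ k := by
    have := Nat.lt_floor_add_one (c * m / 32)
    have h3 : (64:ℝ) ≤ c * m := by nlinarith
    rw [← hk] at this; linarith
  have hmn : (m:ℝ) ≤ n / 16 := by nlinarith
  have hkn : (k:ℝ) ≤ n / 16 := by nlinarith
  have hm0 : (0:ℝ) < m := lt_of_lt_of_le (by positivity) hm2
  have hkp : (0:ℝ) < k := lt_of_lt_of_le (by positivity) hk2
  have hmn' : m < n := by
    have : (m:ℝ) < n := by linarith
    exact_mod_cast this
  have hkn' : 2 * k ≤ n := by
    have : (2:ℝ) * k ≤ n := by linarith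
    exact_mod_cast this
  have hk0 : 0 < k := by exact_mod_cast hkp
  obtain ⟨K, -, hKc, hKs⟩ := avg_select (fun i => ∑ j, (eC E i j : ℝ)) k univ (by simp; omega)
  obtain ⟨M, -, hMc, hMs⟩ := avg_select (fun j => ∑ i ∈ K, (eC E i j : ℝ)) m univ (by simp; omega)
  simp only [card_univ, Fintype.card_fin] at hKs hMs
  rw [sum_comm (s := univ), sum_comm (s := M)] at hMs
  have hS : c * k * m * n ≤ ∑ i ∈ K, ∑ j ∈ M, (eC E i j : ℝ) := by
    have a : (m:ℝ) * (k * (c * n^3)) ≤ m * (k * ∑ i, ∑ j, (eC E i j : ℝ)) := by gcongr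
    have b : (m:ℝ) * (k * ∑ i, ∑ j, (eC E i j : ℝ)) ≤ m * (n * ∑ i ∈ K, ∑ j, (eC E i j : ℝ)) := by gcongr
    have d : (n:ℝ) * (m * ∑ i ∈ K, ∑ j, (eC E i j : ℝ)) ≤ n * (n * ∑ i ∈ K, ∑ j ∈ M, (eC E i j : ℝ)) := by gcongr
    have e : (n:ℝ)^2 * (c * k * m * n) ≤ n^2 * ∑ i ∈ K, ∑ j ∈ M, (eC E i j : ℝ) := by linarith
    exact le_of_mul_le_mul_left e (by positivity)
  have hkm : q * n^2 ≤ k * m := by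
    calc q * (n:ℝ)^2 = c / 64 * (c * n / 32)^2 := by rw [hq]; ring
      _ ≤ c / 64 * m^2 := by gcongr
      _ = (c * m / 64) * m := by ring
      _ ≤ k * m := by gcongr
  have h1 := few_hits2 hn0 K M E c (by rw [hKc, hMc]; exact hS) (c / 4 * q * (n:ℝ)^2) (by positivity)
    (by rw [hKc, hMc]; nlinarith)
  rw [hKc, hMc] at h1
  have h2 := ratio_bound n k m hkn' hmn' hk0
  calc _ ≤ ((univ.filter fun L : LatinSquare n =>
      (((K ×ˢ M).filter fun p => E p.1 p.2 (L.1 p.1 p.2)).card : ℝ) ≤ c / 4 * q * (n:ℝ)^2).card : ℝ) := by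
        have : (univ.filter fun L : LatinSquare n =>
          ((univ.filter fun p : Fin n × Fin n => E p.1 p.2 (L.1 p.1 p.2)).card : ℝ) ≤ c / 4 * q * (n:ℝ)^2) ⊆
          (univ.filter fun L : LatinSquare n =>
          (((K ×ˢ M).filter fun p => E p.1 p.2 (L.1 p.1 p.2)).card : ℝ) ≤ c / 4 * q * (n:ℝ)^2) := by
          intro L hL
          rw [mem_filter] at hL ⊢
          refine ⟨mem_univ _, le_trans ?_ hL.2⟩
          exact_mod_cast card_le_card (filter_subset_filter _ (subset_univ _))
        exact_mod_cast card_le_card this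
    _ ≤ _ := h1
    _ = (((n - m).factorial : ℝ) ^ k * Real.exp (∑ t ∈ range (n - k), n * gB (n - k - t)) *
      (n : ℝ) ^ (k * m)) * Real.exp (- (c / 4 * k * m)) := by ring
    _ ≤ (Real.exp (2 * k ^ 2 + k * m ^ 2 / n + 2 * n * (1 + Real.log n) ^ 2) *
      (Fintype.card (LatinSquare n) : ℝ)) * Real.exp (- (c / 4 * k * m)) := by gcongr
    _ = Real.exp (2 * k ^ 2 + k * m ^ 2 / n + 2 * n * (1 + Real.log n) ^ 2 + - (c / 4 * k * m)) *
      (Fintype.card (LatinSquare n) : ℝ) := by rw [Real.exp_add _ (- (c / 4 * k * m))]; ring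
    _ ≤ _ := by
        gcongr
        have a : (k:ℝ) * m^2 / n ≤ c / 16 * (k * m) := by
          rw [div_le_iff₀ hnp]
          calc (k:ℝ) * m^2 = (k * m) * m := by ring
            _ ≤ (k * m) * (c * n / 16) := by gcongr
            _ = _ := by ring
        have b : 2 * (k:ℝ)^2 ≤ c / 16 * (k * m) := by nlinarith
        have d : c / 8 * (q * n^2) ≤ c / 8 * (k * m) := by gcongr
        nlinarith


lemma desc_ineq (a b n : ℕ) (h : b ≤ n) :
    b.descFactorial a * n ^ a ≤ b ^ a * n.descFactorial a := by
  induction a with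
  | zero => simp
  | succ a ih =>
    rw [Nat.descFactorial_succ, Nat.descFactorial_succ, pow_succ, pow_succ]
    have : (b - a) * n ≤ b * (n - a) := by
      rcases le_total b a with hb | hb
      · simp [Nat.sub_eq_zero_of_le hb]
      · zify [hb, hb.trans h]
        have : (b:ℤ) ≤ n := by exact_mod_cast h
        nlinarith
    calc _ = ((b - a) * n) * (b.descFactorial a * n ^ a) := by ring
      _ ≤ (b * (n - a)) * (b ^ a * n.descFactorial a) := Nat.mul_le_mul this ih
      _ = _ := by ring

lemma perm_into {n : ℕ} (A B : Finset (Fin n)) :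
    (univ.filter fun σ : Equiv.Perm (Fin n) => ∀ x ∈ A, σ x ∈ B).card * n ^ A.card ≤
      B.card ^ A.card * n.factorial := by
  have hA : A.card ≤ n := by simpa using card_le_univ A
  have hB : B.card ≤ n := by simpa using card_le_univ B
  have h1 : (univ.filter fun σ : Equiv.Perm (Fin n) => ∀ x ∈ A, σ x ∈ B).card ≤
      (n - A.card).factorial * B.card.descFactorial A.card := by
    have := Finset.card_le_mul_card_image_of_maps_to
      (s := (univ : Finset {σ : Equiv.Perm (Fin n) // ∀ x ∈ A, σ x ∈ B}))
      (t := (univ : Finset (↥A ↪ ↥B)))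
      (f := fun σ => ⟨fun x => ⟨σ.1 x.1, σ.2 x.1 x.2⟩, fun x y h => by
        have h := congrArg Subtype.val h
        exact Subtype.ext (σ.1.injective h)⟩) (by simp) (n - A.card).factorial ?_
    · rw [card_univ, card_univ, Fintype.card_embedding_eq, Fintype.card_coe, Fintype.card_coe,
        Fintype.card_subtype] at this
      exact this
    · intro f _
      refine le_trans ?_ (perm_restrict A (fun x => if h : x ∈ A then (f ⟨x, h⟩).1 else x))
      refine Finset.card_le_card_of_injOn Subtype.val ?_ (Subtype.val_injective.injOn)
      intro σ hσ
      have hσ := (mem_filter.mp (mem_coe.mp hσ)).2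
      simp only [mem_coe, mem_filter, mem_univ, true_and]
      intro j hj
      rw [dif_pos hj, ← hσ]
      rfl
  calc _ ≤ (n - A.card).factorial * B.card.descFactorial A.card * n ^ A.card :=
        Nat.mul_le_mul_right _ h1
    _ = (n - A.card).factorial * (B.card.descFactorial A.card * n ^ A.card) := by ring
    _ ≤ (n - A.card).factorial * (B.card ^ A.card * n.descFactorial A.card) :=
        Nat.mul_le_mul_left _ (desc_ineq _ _ _ hB)
    _ = B.card ^ A.card * ((n - A.card).factorial * n.descFactorial A.card) := by ring
    _ = _ := by rw [Nat.factorial_mul_descFactorial hA]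

def hits {n : ℕ} (A B : Finset (Fin n)) (σ : Equiv.Perm (Fin n)) : ℕ := (A.filter fun x => σ x ∈ B).card

lemma perm_mgf {n : ℕ} (hn : 0 < n) (A B : Finset (Fin n)) (t : ℝ) (ht : 0 ≤ t) :
    ∑ σ : Equiv.Perm (Fin n), (1 + t) ^ hits A B σ ≤
      n.factorial * Real.exp (t * A.card * B.card / n) := by
  have hnp : (0:ℝ) < n := by exact_mod_cast hn
  have h1 : ∀ σ : Equiv.Perm (Fin n), (1 + t) ^ hits A B σ =
      ∑ S ∈ A.powerset, t ^ S.card * (if ∀ x ∈ S, σ x ∈ B then 1 else 0) := by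
    intro σ
    have : (1 + t) ^ hits A B σ = ∏ x ∈ A, (1 + if σ x ∈ B then t else 0) := by
      have : ∀ x, (1 + if σ x ∈ B then t else 0) = if σ x ∈ B then 1 + t else 1 := by
        intro x; split_ifs <;> simp
      simp_rw [this]
      rw [prod_ite]; simp [hits]
    rw [this, prod_one_add]
    refine sum_congr rfl fun S _ => ?_
    split_ifs with h
    · rw [prod_congr rfl (fun x hx => if_pos (h x hx))]; simp
    · push Not at h
      obtain ⟨x, hx, hxB⟩ := h
      rw [mul_zero]
      exact prod_eq_zero hx (if_neg hxB)
  simp_rw [h1]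
  rw [sum_comm]
  calc _ = ∑ S ∈ A.powerset, t ^ S.card *
        ((univ.filter fun σ : Equiv.Perm (Fin n) => ∀ x ∈ S, σ x ∈ B).card : ℝ) := by
        refine sum_congr rfl fun S _ => ?_
        rw [← mul_sum, sum_boole]
    _ ≤ ∑ S ∈ A.powerset, t ^ S.card * (n.factorial * ((B.card : ℝ) / n) ^ S.card) := by
        refine sum_le_sum fun S _ => ?_
        refine mul_le_mul_of_nonneg_left ?_ (by positivity)
        have := perm_into S B
        rw [div_pow, mul_div_assoc', le_div_iff₀ (by positivity), mul_comm (n.factorial : ℝ)]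
        exact_mod_cast this
    _ = n.factorial * ∑ S ∈ A.powerset, ∏ x ∈ S, (t * B.card / n) := by
        rw [mul_sum]
        refine sum_congr rfl fun S _ => ?_
        rw [prod_const, mul_div_assoc, mul_pow]; ring
    _ = n.factorial * (1 + t * B.card / n) ^ A.card := by
        rw [← prod_one_add, prod_const]
    _ ≤ n.factorial * (Real.exp (t * B.card / n)) ^ A.card := by
        gcongr
        rw [add_comm]; exact Real.add_one_le_exp _
    _ = _ := by
        rw [← Real.exp_nat_mul]; congr 2; ring

/-- `τ` is equivariant for a transitive action. -/
def Equivar {n : ℕ} (τ : LatinSquare n → Equiv.Perm (Fin n)) : Prop :=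
  ∀ σ : Equiv.Perm (Fin n), ∃ g : LatinSquare n → LatinSquare n, Function.Injective g ∧
    ∀ L, τ (g L) = σ * τ L

lemma unif {n : ℕ} (τ : LatinSquare n → Equiv.Perm (Fin n)) (hτ : Equivar τ)
    (f : Equiv.Perm (Fin n) → ℝ) :
    n.factorial * ∑ L, f (τ L) = Fintype.card (LatinSquare n) * ∑ σ, f σ := by
  have h1 : ∀ σ : Equiv.Perm (Fin n), ∑ L, f (τ L) = ∑ L, f (σ * τ L) := by
    intro σ
    obtain ⟨g, hg, hg2⟩ := hτ σ
    have hb : Function.Bijective g := Finite.injective_iff_bijective.mp hg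
    rw [← Function.Bijective.sum_comp hb (fun L => f (τ L))]
    simp_rw [hg2]
  calc _ = ∑ σ : Equiv.Perm (Fin n), ∑ L, f (τ L) := by
        rw [sum_const, card_univ, Fintype.card_perm, Fintype.card_fin, nsmul_eq_mul]
    _ = ∑ σ : Equiv.Perm (Fin n), ∑ L, f (σ * τ L) := sum_congr rfl fun σ _ => h1 σ
    _ = ∑ L : LatinSquare n, ∑ σ : Equiv.Perm (Fin n), f σ := by
        rw [sum_comm]
        refine sum_congr rfl fun L _ => ?_
        exact Fintype.sum_equiv (Equiv.mulRight (τ L)) _ _ (fun σ => rfl)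
    _ = _ := by rw [sum_const, card_univ, nsmul_eq_mul]

def HH {n d : ℕ} (τ : LatinSquare n → Equiv.Perm (Fin n)) (A B : Finset (Fin n))
    (Ls : Fin d → LatinSquare n) : ℕ := ∑ m, hits A B (τ (Ls m))

lemma chernoff {n d : ℕ} (hn : 0 < n) (τ : LatinSquare n → Equiv.Perm (Fin n)) (hτ : Equivar τ)
    (A B : Finset (Fin n)) (t : ℝ) (ht : 0 ≤ t) (x : ℝ) :
    ((univ.filter fun Ls : Fin d → LatinSquare n => x < (HH τ A B Ls : ℝ)).card : ℝ) ≤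
      (Fintype.card (LatinSquare n) : ℝ) ^ d *
      Real.exp (d * (t * A.card * B.card / n) - x * Real.log (1 + t)) := by
  have h1t : (1:ℝ) ≤ 1 + t := by linarith
  have h1 : ∑ L, (1 + t) ^ hits A B (τ L) ≤ Fintype.card (LatinSquare n) *
      Real.exp (t * A.card * B.card / n) := by
    have a := unif τ hτ (fun σ => (1 + t) ^ hits A B σ)
    have b := mul_le_mul_of_nonneg_left (perm_mgf hn A B t ht)
      (Nat.cast_nonneg (α := ℝ) (Fintype.card (LatinSquare n)))
    rw [← a] at b
    have hf : (0:ℝ) < n.factorial := by positivity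
    refine le_of_mul_le_mul_left (b.trans (le_of_eq ?_)) hf
    ring
  have h2 : ∑ Ls : Fin d → LatinSquare n, (1 + t) ^ HH τ A B Ls =
      (∑ L, (1 + t) ^ hits A B (τ L)) ^ d := by
    have := Finset.prod_univ_sum (fun _ : Fin d => (univ : Finset (LatinSquare n)))
      (fun _ L => (1 + t) ^ hits A B (τ L))
    rw [Fintype.piFinset_univ] at this
    rw [← Fin.prod_const, this]
    refine sum_congr rfl fun Ls _ => ?_
    rw [HH, ← prod_pow_eq_pow_sum]
  calc _ = ∑ Ls ∈ (univ.filter fun Ls : Fin d → LatinSquare n => x < (HH τ A B Ls : ℝ)), (1:ℝ) := by simp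
    _ ≤ ∑ Ls ∈ (univ.filter fun Ls : Fin d → LatinSquare n => x < (HH τ A B Ls : ℝ)),
        (1 + t) ^ HH τ A B Ls * Real.exp (- x * Real.log (1 + t)) := by
        refine sum_le_sum fun Ls hLs => ?_
        have h := (mem_filter.mp hLs).2
        have e : (1 + t) ^ HH τ A B Ls = Real.exp (HH τ A B Ls * Real.log (1 + t)) := by
          rw [Real.exp_nat_mul, Real.exp_log (by linarith)]
        rw [e, ← Real.exp_add]
        apply Real.one_le_exp
        have := Real.log_nonneg h1t
        nlinarith
    _ ≤ ∑ Ls : Fin d → LatinSquare n, (1 + t) ^ HH τ A B Ls * Real.exp (- x * Real.log (1 + t)) :=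
        sum_le_sum_of_subset_of_nonneg (filter_subset _ _) fun _ _ _ => by positivity
    _ = (∑ L, (1 + t) ^ hits A B (τ L)) ^ d * Real.exp (- x * Real.log (1 + t)) := by
        rw [← sum_mul, h2]
    _ ≤ (Fintype.card (LatinSquare n) * Real.exp (t * A.card * B.card / n)) ^ d *
          Real.exp (- x * Real.log (1 + t)) := by
        gcongr
        
    _ = _ := by
        rw [mul_pow, ← Real.exp_nat_mul, mul_assoc, ← Real.exp_add]
        congr 2; ring


def cst : ℝ := Real.exp (-50)

lemma cst_pos : 0 < cst := Real.exp_pos _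

lemma log_ratio {n s : ℕ} (hn : 0 < n) (hs : 0 < s) (h : (s:ℝ) ≤ cst * n) :
    50 ≤ Real.log (n / s) ∧ Real.log n ≤ s * Real.log (n / s) := by
  have hn' : (0:ℝ) < n := by exact_mod_cast hn
  have hs' : (0:ℝ) < s := by exact_mod_cast hs
  have h1 : 50 ≤ Real.log (n / s) := by
    rw [Real.le_log_iff_exp_le (by positivity), le_div_iff₀ hs']
    calc Real.exp 50 * s ≤ Real.exp 50 * (cst * n) := by gcongr
      _ = n := by rw [cst, ← mul_assoc, ← Real.exp_add]; norm_num
  refine ⟨h1, ?_⟩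
  have h2 : Real.log n = Real.log (n / s) + Real.log s := by
    rw [Real.log_div (by positivity) (by positivity)]; ring
  have h3 := Real.log_le_sub_one_of_pos hs'
  have h4 : (1:ℝ) ≤ s := by exact_mod_cast hs
  nlinarith

lemma ab_le {n : ℕ} (U : Finset (Fin n ⊕ Fin n)) :
    (U.toLeft.card : ℝ) * U.toRight.card ≤ (U.card : ℝ) ^ 2 / 4 := by
  have : (U.card : ℝ) = U.toLeft.card + U.toRight.card := by
    exact_mod_cast (card_toLeft_add_card_toRight (u := U)).symm
  rw [this]; nlinarith [sq_nonneg ((U.toLeft.card : ℝ) - U.toRight.card)]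

lemma caseI {n d : ℕ} (hn : 0 < n) (hd : 1000 ≤ d) (τ : LatinSquare n → Equiv.Perm (Fin n))
    (hτ : Equivar τ) (U : Finset (Fin n ⊕ Fin n)) (hs : 0 < U.card) (h : (U.card:ℝ) ≤ cst * n) :
    ((univ.filter fun Ls : Fin d → LatinSquare n =>
      1 / 100 * d * U.card < (HH τ U.toLeft U.toRight Ls : ℝ)).card : ℝ) ≤
      (Fintype.card (LatinSquare n) : ℝ) ^ d * Real.exp (- (5 * (U.card * Real.log (n / U.card)))) := by
  obtain ⟨hl, -⟩ := log_ratio hn hs h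
  have hn' : (0:ℝ) < n := by exact_mod_cast hn
  have hs' : (0:ℝ) < U.card := by exact_mod_cast hs
  have hd' : (1000:ℝ) ≤ d := by exact_mod_cast hd
  have hns : (1:ℝ) ≤ n / U.card := by
    by_contra hh
    have := Real.log_nonpos (by positivity) (not_le.mp hh).le
    linarith
  refine (chernoff hn τ hτ U.toLeft U.toRight (n / U.card - 1) (by linarith) _).trans ?_
  gcongr
  rw [add_sub_cancel]
  have hab := ab_le U
  have h1 : ((n:ℝ) / U.card - 1) * U.toLeft.card * U.toRight.card / n ≤ U.card / 4 := by
    calc _ = ((n:ℝ) / U.card - 1) * (U.toLeft.card * U.toRight.card) / n := by ring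
      _ ≤ ((n:ℝ) / U.card) * ((U.card : ℝ) ^ 2 / 4) / n := by
          gcongr; linarith
      _ = _ := by field_simp
  have h2 : (d:ℝ) * (((n:ℝ) / U.card - 1) * U.toLeft.card * U.toRight.card / n) ≤ d * (U.card / 4) := by gcongr
  have h3 : (d:ℝ) * U.card * 50 ≤ d * U.card * Real.log (n / U.card) := by gcongr
  have h4 : (1000:ℝ) * (U.card * Real.log (n / U.card)) ≤ d * (U.card * Real.log (n / U.card)) := by
    have : 0 ≤ Real.log ((n:ℝ) / U.card) := by linarith
    gcongr
  linarith

lemma caseII {n d : ℕ} (hn : 0 < n) (τ : LatinSquare n → Equiv.Perm (Fin n))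
    (hτ : Equivar τ) (U : Finset (Fin n ⊕ Fin n)) (hd : 40 ≤ cst * d) (h : cst * n ≤ U.card)
    (h' : U.card ≤ n) :
    ((univ.filter fun Ls : Fin d → LatinSquare n =>
      45 / 100 * d * U.card < (HH τ U.toLeft U.toRight Ls : ℝ)).card : ℝ) ≤
      (Fintype.card (LatinSquare n) : ℝ) ^ d * Real.exp (- (2.4 * n)) := by
  have hn' : (0:ℝ) < n := by exact_mod_cast hn
  have hs' : (U.card : ℝ) ≤ n := by exact_mod_cast h'
  refine (chernoff hn τ hτ U.toLeft U.toRight 1 (by norm_num) _).trans ?_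
  gcongr
  have hab := ab_le U
  have h1 : (1:ℝ) * U.toLeft.card * U.toRight.card / n ≤ U.card / 4 := by
    rw [div_le_iff₀ hn']; nlinarith
  have h2 : (d:ℝ) * ((1:ℝ) * U.toLeft.card * U.toRight.card / n) ≤ d * (U.card / 4) := by gcongr
  have hl := Real.log_two_gt_d9
  have h12 : (1:ℝ) + 1 = 2 := by norm_num
  rw [h12]
  have h3 : (d:ℝ) * U.card * 0.6931471803 ≤ d * U.card * Real.log 2 := by gcongr
  have h4 : (40:ℝ) * n ≤ d * U.card := by
    calc (40:ℝ) * n ≤ (cst * d) * n := by gcongr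
      _ = d * (cst * n) := by ring
      _ ≤ _ := by gcongr
  nlinarith

def GoodT {n d : ℕ} (τ : LatinSquare n → Equiv.Perm (Fin n)) (Ls : Fin d → LatinSquare n) : Prop :=
  ∀ A B : Finset (Fin n),
    (0 < A.card + B.card → ((A.card + B.card : ℕ):ℝ) ≤ cst * n →
      (HH τ A B Ls : ℝ) ≤ 1 / 100 * d * (A.card + B.card : ℕ)) ∧
    (cst * n ≤ (A.card + B.card : ℕ) → A.card + B.card ≤ n →
      (HH τ A B Ls : ℝ) ≤ 45 / 100 * d * (A.card + B.card : ℕ))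

lemma choose_bound {n s : ℕ} (hn : 0 < n) (hs : 0 < s) (h : (s:ℝ) ≤ cst * n) :
    ((2 * n).choose s : ℝ) * Real.exp (- (5 * (s * Real.log (n / s)))) ≤ ((n:ℝ)^3)⁻¹ := by
  obtain ⟨h1, h2⟩ := log_ratio hn hs h
  have hn' : (0:ℝ) < n := by exact_mod_cast hn
  have hs' : (0:ℝ) < s := by exact_mod_cast hs
  have h3 : ((2 * n).choose s : ℝ) ≤ Real.exp (2 * (s * Real.log (n / s))) := by
    calc ((2 * n).choose s : ℝ) ≤ ((2 * n : ℕ) : ℝ) ^ s / s.factorial := Nat.choose_le_pow_div _ _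
      _ = (s : ℝ) ^ s / s.factorial * (2 * (n / s)) ^ s := by
          push_cast
          rw [mul_pow, mul_pow, div_pow]; field_simp
      _ ≤ Real.exp s * (2 * (n / s)) ^ s := by
          gcongr; exact Real.pow_div_factorial_le_exp _ hs'.le _
      _ = Real.exp (s * (1 + (Real.log 2 + Real.log (n / s)))) := by
          rw [← Real.log_mul (by norm_num) (by positivity), mul_add, Real.exp_add, mul_one,
            Real.exp_nat_mul, Real.exp_log (by positivity)]
      _ ≤ _ := by
          rw [Real.exp_le_exp]
          have := Real.log_two_lt_d9
          nlinarith
  calc _ ≤ Real.exp (2 * (s * Real.log (n / s))) * Real.exp (- (5 * (s * Real.log (n / s)))) := by gcongr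
    _ = Real.exp (- (3 * (s * Real.log (n / s)))) := by rw [← Real.exp_add]; congr 1; ring
    _ ≤ Real.exp (- ((3:ℕ) * Real.log n)) := by
        rw [Real.exp_le_exp]; push_cast; linarith
    _ = _ := by rw [Real.exp_neg, Real.exp_nat_mul, Real.exp_log hn']

lemma link_bad {n d : ℕ} (hn : 0 < n) (hd : 1000 ≤ d) (hd2 : 40 ≤ cst * d)
    (τ : LatinSquare n → Equiv.Perm (Fin n)) (hτ : Equivar τ) :
    ((univ.filter fun Ls : Fin d → LatinSquare n => ¬ GoodT τ Ls).card : ℝ) ≤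
      (Fintype.card (LatinSquare n) : ℝ) ^ d * (5 / (n:ℝ)^2) := by
  have hn' : (0:ℝ) < n := by exact_mod_cast hn
  set N : ℝ := (Fintype.card (LatinSquare n) : ℝ) ^ d with hN
  have hN0 : 0 ≤ N := by positivity
  let S1 : Finset (Finset (Fin n ⊕ Fin n)) := univ.filter fun U => 0 < U.card ∧ (U.card:ℝ) ≤ cst * n
  let S2 : Finset (Finset (Fin n ⊕ Fin n)) := univ.filter fun U => cst * n ≤ U.card ∧ U.card ≤ n
  let F1 : Finset (Fin n ⊕ Fin n) → Finset (Fin d → LatinSquare n) := fun U =>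
    univ.filter fun Ls : Fin d → LatinSquare n => 1 / 100 * d * U.card < (HH τ U.toLeft U.toRight Ls : ℝ)
  let F2 : Finset (Fin n ⊕ Fin n) → Finset (Fin d → LatinSquare n) := fun U =>
    univ.filter fun Ls : Fin d → LatinSquare n => 45 / 100 * d * U.card < (HH τ U.toLeft U.toRight Ls : ℝ)
  have hsub : (univ.filter fun Ls : Fin d → LatinSquare n => ¬ GoodT τ Ls) ⊆
      S1.biUnion F1 ∪ S2.biUnion F2 := by
    intro Ls hLs
    have h := (mem_filter.mp hLs).2
    unfold GoodT at h
    push Not at h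
    obtain ⟨A, B, h⟩ := h
    rw [mem_union, mem_biUnion, mem_biUnion]
    by_cases h1 : (0 < A.card + B.card → ((A.card + B.card : ℕ):ℝ) ≤ cst * n →
      (HH τ A B Ls : ℝ) ≤ 1 / 100 * d * (A.card + B.card : ℕ))
    · right
      obtain ⟨ha, hb, hc⟩ := h h1
      refine ⟨A.disjSum B, ?_, ?_⟩
      · simp only [S2, mem_filter, mem_univ, true_and, card_disjSum]; exact ⟨ha, hb⟩
      · simp only [F2, mem_filter, mem_univ, true_and, card_disjSum, toLeft_disjSum, toRight_disjSum]
        exact hc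
    · left
      push Not at h1
      obtain ⟨ha, hb, hc⟩ := h1
      refine ⟨A.disjSum B, ?_, ?_⟩
      · simp only [S1, mem_filter, mem_univ, true_and, card_disjSum]; exact ⟨ha, hb⟩
      · simp only [F1, mem_filter, mem_univ, true_and, card_disjSum, toLeft_disjSum, toRight_disjSum]
        exact hc
  have hcard : (univ.filter fun Ls : Fin d → LatinSquare n => ¬ GoodT τ Ls).card ≤
      ∑ U ∈ S1, (F1 U).card + ∑ U ∈ S2, (F2 U).card :=
    (card_le_card hsub).trans ((card_union_le _ _).trans (Nat.add_le_add card_biUnion_le card_biUnion_le))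
  have b1 : ∑ U ∈ S1, ((F1 U).card : ℝ) ≤ N * (3 / (n:ℝ)^2) := by
    let w : ℕ → ℝ := fun s => if 0 < s ∧ (s:ℝ) ≤ cst * n then Real.exp (- (5 * (s * Real.log (n / s)))) else 0
    calc _ ≤ ∑ U ∈ S1, N * w U.card := by
          refine sum_le_sum fun U hU => ?_
          have hU := (mem_filter.mp hU).2
          simp only [w, if_pos hU]
          exact caseI hn hd τ hτ U hU.1 hU.2
      _ ≤ ∑ U : Finset (Fin n ⊕ Fin n), N * w U.card := by
          refine sum_le_sum_of_subset_of_nonneg (subset_univ _) fun U _ _ => ?_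
          refine mul_nonneg hN0 ?_
          simp only [w]; split_ifs <;> positivity
      _ = N * ∑ s ∈ range (2 * n + 1), (2 * n).choose s • w s := by
          rw [← mul_sum]
          have := Finset.sum_powerset_apply_card w (x := (univ : Finset (Fin n ⊕ Fin n)))
          rw [powerset_univ] at this
          rw [this]
          have e : (univ : Finset (Fin n ⊕ Fin n)).card = 2 * n := by simp; ring
          rw [e]
      _ ≤ N * ∑ s ∈ range (2 * n + 1), ((n:ℝ)^3)⁻¹ := by
          gcongr with s _
          simp only [w]
          split_ifs with h
          · rw [nsmul_eq_mul]; exact choose_bound hn h.1 h.2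
          · simp
      _ ≤ _ := by
          rw [sum_const, card_range, nsmul_eq_mul]
          gcongr
          rw [le_div_iff₀ (by positivity)]
          have h1 : (1:ℝ) ≤ n := by exact_mod_cast hn
          push_cast
          calc (2 * (n:ℝ) + 1) * ((n:ℝ)^3)⁻¹ * n^2 = (2 * n + 1) / n := by field_simp
            _ ≤ 3 := by rw [div_le_iff₀ hn']; linarith
  have b2 : ∑ U ∈ S2, ((F2 U).card : ℝ) ≤ N * (2 / (n:ℝ)^2) := by
    calc _ ≤ ∑ U ∈ S2, N * Real.exp (- (2.4 * n)) := by
          refine sum_le_sum fun U hU => ?_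
          have hU := (mem_filter.mp hU).2
          exact caseII hn τ hτ U hd2 hU.1 hU.2
      _ = S2.card * (N * Real.exp (- (2.4 * n))) := by rw [sum_const, nsmul_eq_mul]
      _ ≤ Real.exp (1.4 * n) * (N * Real.exp (- (2.4 * n))) := by
          gcongr
          have h1 : S2.card ≤ 2 ^ (2 * n) := by
            refine (card_le_univ _).trans (le_of_eq ?_)
            simp; ring
          calc (S2.card : ℝ) ≤ (2:ℝ) ^ (2 * n) := by exact_mod_cast h1
            _ = Real.exp ((2 * n : ℕ) * Real.log 2) := by
                rw [Real.exp_nat_mul, Real.exp_log (by norm_num)]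
            _ ≤ _ := by
                rw [Real.exp_le_exp]; push_cast
                have := Real.log_two_lt_d9
                nlinarith
      _ = N * Real.exp (- n) := by
          rw [mul_left_comm, ← Real.exp_add]; congr 2; ring
      _ ≤ _ := by
          gcongr
          have := Real.quadratic_le_exp_of_nonneg hn'.le
          rw [Real.exp_neg, le_div_iff₀ (by positivity), inv_mul_le_iff₀ (Real.exp_pos _)]
          nlinarith
  calc _ ≤ ∑ U ∈ S1, ((F1 U).card : ℝ) + ∑ U ∈ S2, ((F2 U).card : ℝ) := by exact_mod_cast hcard
    _ ≤ N * (3 / (n:ℝ)^2) + N * (2 / (n:ℝ)^2) := add_le_add b1 b2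
    _ = _ := by ring

def tauA {n : ℕ} (i : Fin n) (L : LatinSquare n) : Equiv.Perm (Fin n) := L.1 i

lemma tauB_inj {n : ℕ} (j : Fin n) (L : LatinSquare n) : Function.Injective (fun i => L.1 i j) := by
  intro i i' h
  by_contra hne
  exact L.2 i i' hne j h

def tauB {n : ℕ} (j : Fin n) (L : LatinSquare n) : Equiv.Perm (Fin n) :=
  Equiv.ofBijective (fun i => L.1 i j) (Finite.injective_iff_bijective.mp (tauB_inj j L))

lemma tauC_inj {n : ℕ} (k : Fin n) (L : LatinSquare n) :
    Function.Injective (fun i => (L.1 i).symm k) := by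
  intro i i' h
  have h : (L.1 i).symm k = (L.1 i').symm k := h
  by_contra hne
  refine L.2 i i' hne ((L.1 i).symm k) ?_
  rw [Equiv.apply_symm_apply, h, Equiv.apply_symm_apply]

def tauC {n : ℕ} (k : Fin n) (L : LatinSquare n) : Equiv.Perm (Fin n) :=
  Equiv.ofBijective (fun i => (L.1 i).symm k) (Finite.injective_iff_bijective.mp (tauC_inj k L))

def lmulL {n : ℕ} (σ : Equiv.Perm (Fin n)) (L : LatinSquare n) : LatinSquare n :=
  ⟨fun i => σ * L.1 i, fun i j h x hx => L.2 i j h x (σ.injective hx)⟩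

def rmulL {n : ℕ} (σ : Equiv.Perm (Fin n)) (L : LatinSquare n) : LatinSquare n :=
  ⟨fun i => L.1 i * σ⁻¹, fun i j h x hx => L.2 i j h (σ⁻¹ x) hx⟩

lemma lmulL_inj {n : ℕ} (σ : Equiv.Perm (Fin n)) : Function.Injective (lmulL σ) := by
  intro L L' h
  apply Subtype.ext; funext i
  exact mul_left_cancel (congrFun (congrArg Subtype.val h) i)

lemma rmulL_inj {n : ℕ} (σ : Equiv.Perm (Fin n)) : Function.Injective (rmulL σ) := by
  intro L L' h
  apply Subtype.ext; funext i
  exact mul_right_cancel (congrFun (congrArg Subtype.val h) i)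

lemma equivarA {n : ℕ} (i : Fin n) : Equivar (tauA i) := fun σ =>
  ⟨lmulL σ, lmulL_inj σ, fun L => rfl⟩

lemma equivarB {n : ℕ} (i : Fin n) : Equivar (tauB i) := fun σ =>
  ⟨lmulL σ, lmulL_inj σ, fun L => by ext x; rfl⟩

lemma equivarC {n : ℕ} (i : Fin n) : Equivar (tauC i) := fun σ =>
  ⟨rmulL σ, rmulL_inj σ, fun L => by
    refine Equiv.ext fun x => ?_
    show (L.1 x * σ⁻¹).symm i = σ ((L.1 x).symm i)
    rw [Equiv.symm_apply_eq]; simp⟩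


def chi (z : ZMod 2) : ℕ := if z ≠ 0 then 1 else 0

lemma chi_add (a b : ZMod 2) : chi (a + b) ≤ chi a + chi b := by
  unfold chi; revert a b; decide

lemma norm1_eq {n : ℕ} (φ : Cochain1 n) : norm1 φ = ∑ i, ∑ j, chi (φ.ab i j) +
    ∑ i, ∑ k, chi (φ.ac i k) + ∑ j, ∑ k, chi (φ.bc j k) := by
  unfold norm1 chi
  simp only [card_filter, ← Finset.univ_product_univ, Finset.sum_product]

lemma normClass1_le {n : ℕ} (φ : Cochain1 n) (ψ) : normClass1 φ ≤ norm1 (φ + d0 ψ) :=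
  Nat.sInf_le ⟨ψ, rfl⟩

lemma d1_add_d0 {n : ℕ} (φ : Cochain1 n) (ψ) (i j k) : d1 (φ + d0 ψ) i j k = d1 φ i j k := by
  show (φ.ab i j + (ψ (0,i) + ψ (1,j))) + (φ.ac i k + (ψ (0,i) + ψ (2,k))) + (φ.bc j k + (ψ (1,j) + ψ (2,k)))
    = φ.ab i j + φ.ac i k + φ.bc j k
  have h : ∀ x : ZMod 2, x + x = 0 := by decide
  linear_combination h (ψ (0,i)) + h (ψ (1,j)) + h (ψ (2,k))

lemma Tn_bound {n : ℕ} (φ : Cochain1 n) (i0 j0 k0 : Fin n) :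
    normClass1 φ ≤ ∑ i, ∑ j, (chi (d1 φ i j k0) + chi (d1 φ i0 j k0)) +
      ∑ i, ∑ k, (chi (d1 φ i j0 k) + chi (d1 φ i j0 k0) + chi (d1 φ i0 j0 k) + chi (d1 φ i0 j0 k0))
      + ∑ j, ∑ k, chi (d1 φ i0 j k) := by
  let ψ : Fin 3 × Fin n → ZMod 2 := fun p =>
    if p.1 = 0 then φ.ac p.2 k0 + φ.ac i0 k0 else if p.1 = 1 then φ.ab i0 p.2 else φ.ac i0 p.2
  have h : ∀ x : ZMod 2, x + x = 0 := by decide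
  refine (normClass1_le φ ψ).trans ?_
  rw [norm1_eq]
  refine Nat.add_le_add (Nat.add_le_add ?_ ?_) ?_
  · refine sum_le_sum fun i _ => sum_le_sum fun j _ => ?_
    refine le_trans (le_of_eq ?_) (chi_add _ _)
    congr 1
    show φ.ab i j + ((φ.ac i k0 + φ.ac i0 k0) + φ.ab i0 j) = _
    unfold d1
    linear_combination - h (φ.bc j k0)
  · refine sum_le_sum fun i _ => sum_le_sum fun k _ => ?_
    refine le_trans (le_of_eq ?_) ((chi_add (d1 φ i j0 k + d1 φ i j0 k0 + d1 φ i0 j0 k) (d1 φ i0 j0 k0)).trans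
      (Nat.add_le_add_right ((chi_add _ _).trans (Nat.add_le_add_right (chi_add _ _) _)) _))
    congr 1
    show φ.ac i k + ((φ.ac i k0 + φ.ac i0 k0) + φ.ac i0 k) = _
    unfold d1
    linear_combination - h (φ.bc j0 k0) - h (φ.bc j0 k) - h (φ.ab i j0) - h (φ.ab i0 j0)
  · refine sum_le_sum fun j _ => sum_le_sum fun k _ => ?_
    refine (le_of_eq ?_)
    congr 1
    show φ.bc j k + (φ.ab i0 j + φ.ac i0 k) = _
    unfold d1
    ring

lemma Tn_exp {n : ℕ} (φ : Cochain1 n) :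
    n * normClass1 φ ≤ 7 * ∑ i, ∑ j, ∑ k, chi (d1 φ i j k) := by
  rcases Nat.eq_zero_or_pos n with h0 | hn
  · subst h0; simp
  set D := ∑ i, ∑ j, ∑ k, chi (d1 φ i j k) with hD
  have key : ∑ i0 : Fin n, ∑ j0 : Fin n, ∑ k0 : Fin n, normClass1 φ ≤
      ∑ i0 : Fin n, ∑ j0 : Fin n, ∑ k0 : Fin n,
      (∑ i, ∑ j, (chi (d1 φ i j k0) + chi (d1 φ i0 j k0)) +
      ∑ i, ∑ k, (chi (d1 φ i j0 k) + chi (d1 φ i j0 k0) + chi (d1 φ i0 j0 k) + chi (d1 φ i0 j0 k0))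
      + ∑ j, ∑ k, chi (d1 φ i0 j k)) :=
    sum_le_sum fun i _ => sum_le_sum fun j _ => sum_le_sum fun k _ => Tn_bound φ i j k
  have c1 : ∑ k, ∑ i, ∑ j, chi (d1 φ i j k) = D := by
    rw [sum_comm]; refine sum_congr rfl fun i _ => ?_; rw [sum_comm]
  have c2 : ∑ i, ∑ k, ∑ j, chi (d1 φ i j k) = D := by
    refine sum_congr rfl fun i _ => ?_; rw [sum_comm]
  have c3 : ∑ j, ∑ i, ∑ k, chi (d1 φ i j k) = D := by
    rw [sum_comm]
  have c4 : ∑ j, ∑ k, ∑ i, chi (d1 φ i j k) = D := by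
    rw [← c3]; refine sum_congr rfl fun i _ => ?_; rw [sum_comm]
  simp only [sum_add_distrib, sum_const, card_univ, Fintype.card_fin, smul_eq_mul, ← mul_sum] at key
  simp only [c1, c2, c3, c4, ← hD] at key
  have : n ^ 2 * (n * normClass1 φ) ≤ n^2 * (7 * D) := by nlinarith
  exact Nat.le_of_mul_le_mul_left this (by positivity)


def wt {n : ℕ} (φ : Cochain1 n) : (Fin n ⊕ Fin n ⊕ Fin n) → (Fin n ⊕ Fin n ⊕ Fin n) → ℕ
  | .inl i, .inr (.inl j) => chi (φ.ab i j)
  | .inl i, .inr (.inr k) => chi (φ.ac i k)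
  | .inr (.inl j), .inl i => chi (φ.ab i j)
  | .inr (.inl j), .inr (.inr k) => chi (φ.bc j k)
  | .inr (.inr k), .inl i => chi (φ.ac i k)
  | .inr (.inr k), .inr (.inl j) => chi (φ.bc j k)
  | _, _ => 0

lemma chi_le (z : ZMod 2) : chi z ≤ 1 := by unfold chi; split_ifs <;> simp

lemma wt_symm {n : ℕ} (φ : Cochain1 n) (u v) : wt φ u v = wt φ v u := by
  rcases u with i | j | k <;> rcases v with i' | j' | k' <;> rfl

lemma wt_le {n : ℕ} (φ : Cochain1 n) (u v) : wt φ u v ≤ 1 := by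
  rcases u with i | j | k <;> rcases v with i' | j' | k' <;> simp [wt, chi_le]

def dg {n : ℕ} (φ : Cochain1 n) (v : Fin n ⊕ Fin n ⊕ Fin n) : ℕ := ∑ u, wt φ v u

lemma dgA {n : ℕ} (φ : Cochain1 n) (i : Fin n) : dg φ (.inl i) =
    (univ.filter fun j => φ.ab i j ≠ 0).card + (univ.filter fun k => φ.ac i k ≠ 0).card := by
  simp only [dg, Fintype.sum_sum_type, wt, chi, card_filter, sum_const_zero, zero_add]

lemma dgB {n : ℕ} (φ : Cochain1 n) (j : Fin n) : dg φ (.inr (.inl j)) =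
    (univ.filter fun i => φ.ab i j ≠ 0).card + (univ.filter fun k => φ.bc j k ≠ 0).card := by
  simp only [dg, Fintype.sum_sum_type, wt, chi, card_filter, sum_const_zero, zero_add]

lemma dgC {n : ℕ} (φ : Cochain1 n) (k : Fin n) : dg φ (.inr (.inr k)) =
    (univ.filter fun i => φ.ac i k ≠ 0).card + (univ.filter fun j => φ.bc j k ≠ 0).card := by
  simp only [dg, Fintype.sum_sum_type, wt, chi, card_filter, sum_const_zero, add_zero]

lemma sum_dg {n : ℕ} (φ : Cochain1 n) : ∑ v, dg φ v = 2 * norm1 φ := by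
  simp only [dg, Fintype.sum_sum_type, wt, sum_const_zero, add_zero, zero_add, norm1_eq,
    sum_add_distrib]
  rw [sum_comm (f := fun j i => chi (φ.ab i j)), sum_comm (f := fun j i => chi (φ.ac i j)),
    sum_comm (f := fun j i => chi (φ.bc i j))]
  ring

lemma high_low {n : ℕ} (φ : Cochain1 n) (H : Finset (Fin n ⊕ Fin n ⊕ Fin n)) :
    ∑ v ∈ H, dg φ v ≤ ∑ v ∈ Hᶜ, dg φ v + H.card ^ 2 := by
  have h1 : ∑ v ∈ H, dg φ v = ∑ v ∈ H, ∑ u ∈ H, wt φ v u + ∑ v ∈ H, ∑ u ∈ Hᶜ, wt φ v u := by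
    rw [← sum_add_distrib]
    refine sum_congr rfl fun v _ => ?_
    rw [dg, sum_add_sum_compl]
  have h2 : ∑ v ∈ H, ∑ u ∈ H, wt φ v u ≤ H.card ^ 2 := by
    calc _ ≤ ∑ v ∈ H, ∑ u ∈ H, 1 := sum_le_sum fun v _ => sum_le_sum fun u _ => wt_le φ v u
      _ = _ := by simp; ring
  have h3 : ∑ v ∈ H, ∑ u ∈ Hᶜ, wt φ v u ≤ ∑ v ∈ Hᶜ, dg φ v := by
    rw [sum_comm]
    refine sum_le_sum fun u _ => ?_
    simp_rw [wt_symm φ _ u]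
    exact sum_le_sum_of_subset (subset_univ _)
  omega

lemma chi_flip (x : ZMod 2) (b : Prop) [Decidable b] :
    chi (x + if b then 1 else 0) + 2 * (if b then chi x else 0) = chi x + if b then 1 else 0 := by
  by_cases h : b
  · simp only [h, if_true]; revert x; unfold chi; decide
  · simp [h]

lemma sum_flip1 {n : ℕ} (f : Fin n → Fin n → ZMod 2) (i0 : Fin n) :
    ∑ i, ∑ j, chi (f i j + if i = i0 then 1 else 0) + 2 * ∑ j, chi (f i0 j) =
      ∑ i, ∑ j, chi (f i j) + n := by
  have h : ∑ i, ∑ j, (chi (f i j + if i = i0 then 1 else 0) + 2 * (if i = i0 then chi (f i j) else 0)) =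
     ∑ i, ∑ j, (chi (f i j) + if i = i0 then 1 else 0) :=
    sum_congr rfl fun i _ => sum_congr rfl fun j _ => chi_flip _ _
  have e1 : ∑ i, ∑ j, (if i = i0 then chi (f i j) else 0) = ∑ j, chi (f i0 j) := by
    rw [sum_comm]; simp
  have e2 : ∑ i : Fin n, ∑ j : Fin n, (if i = i0 then 1 else 0) = n := by
    rw [sum_comm]; simp
  simp only [sum_add_distrib, ← mul_sum] at h
  rw [e1, e2] at h
  exact h

lemma sum_flip2 {n : ℕ} (f : Fin n → Fin n → ZMod 2) (i0 : Fin n) :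
    ∑ i, ∑ j, chi (f i j + if j = i0 then 1 else 0) + 2 * ∑ i, chi (f i i0) =
      ∑ i, ∑ j, chi (f i j) + n := by
  have := sum_flip1 (fun j i => f i j) i0
  rw [sum_comm, sum_comm (f := fun i j => chi (f i j))]
  exact this

lemma dg_le {n : ℕ} (φ : Cochain1 n) (hmin : ∀ ψ, norm1 φ ≤ norm1 (φ + d0 ψ)) (v) : dg φ v ≤ n := by
  rcases v with i | j | k
  · have h := hmin (fun p => if p = (0, i) then 1 else 0)
    rw [norm1_eq, norm1_eq] at h
    have e1 : ∀ i' j, (φ + d0 (fun p => if p = (0, i) then 1 else 0)).ab i' j =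
      φ.ab i' j + if i' = i then 1 else 0 := by
      intro i' j
      show φ.ab i' j + ((if (0, i') = ((0:Fin 3), i) then 1 else 0) + if (1, j) = ((0:Fin 3), i) then 1 else 0) = _
      simp
    have e2 : ∀ i' j, (φ + d0 (fun p => if p = (0, i) then 1 else 0)).ac i' j =
      φ.ac i' j + if i' = i then 1 else 0 := by
      intro i' j
      show φ.ac i' j + ((if (0, i') = ((0:Fin 3), i) then 1 else 0) + if (2, j) = ((0:Fin 3), i) then 1 else 0) = _
      simp
    have e3 : ∀ i' j, (φ + d0 (fun p => if p = (0, i) then 1 else 0)).bc i' j =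
      φ.bc i' j := by
      intro i' j
      show φ.bc i' j + ((if (1, i') = ((0:Fin 3), i) then 1 else 0) + if (2, j) = ((0:Fin 3), i) then 1 else 0) = _
      simp
    simp only [e1, e2, e3] at h
    have a1 := sum_flip1 φ.ab i
    have a2 := sum_flip1 φ.ac i
    simp only [dg, Fintype.sum_sum_type, wt, sum_const_zero]
    omega
  · have h := hmin (fun p => if p = (1, j) then 1 else 0)
    rw [norm1_eq, norm1_eq] at h
    have e1 : ∀ i' j', (φ + d0 (fun p => if p = (1, j) then 1 else 0)).ab i' j' =
      φ.ab i' j' + if j' = j then 1 else 0 := by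
      intro i' j'
      show φ.ab i' j' + ((if (0, i') = ((1:Fin 3), j) then 1 else 0) + if (1, j') = ((1:Fin 3), j) then 1 else 0) = _
      simp
    have e2 : ∀ i' j', (φ + d0 (fun p => if p = (1, j) then 1 else 0)).ac i' j' =
      φ.ac i' j' := by
      intro i' j'
      show φ.ac i' j' + ((if (0, i') = ((1:Fin 3), j) then 1 else 0) + if (2, j') = ((1:Fin 3), j) then 1 else 0) = _
      simp
    have e3 : ∀ i' j', (φ + d0 (fun p => if p = (1, j) then 1 else 0)).bc i' j' =
      φ.bc i' j' + if i' = j then 1 else 0 := by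
      intro i' j'
      show φ.bc i' j' + ((if (1, i') = ((1:Fin 3), j) then 1 else 0) + if (2, j') = ((1:Fin 3), j) then 1 else 0) = _
      simp
    simp only [e1, e2, e3] at h
    have a1 := sum_flip2 φ.ab j
    have a2 := sum_flip1 φ.bc j
    simp only [dg, Fintype.sum_sum_type, wt, sum_const_zero]
    omega
  · have h := hmin (fun p => if p = (2, k) then 1 else 0)
    rw [norm1_eq, norm1_eq] at h
    have e1 : ∀ i' j', (φ + d0 (fun p => if p = (2, k) then 1 else 0)).ab i' j' =
      φ.ab i' j' := by
      intro i' j'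
      show φ.ab i' j' + ((if (0, i') = ((2:Fin 3), k) then 1 else 0) + if (1, j') = ((2:Fin 3), k) then 1 else 0) = _
      simp
    have e2 : ∀ i' j', (φ + d0 (fun p => if p = (2, k) then 1 else 0)).ac i' j' =
      φ.ac i' j' + if j' = k then 1 else 0 := by
      intro i' j'
      show φ.ac i' j' + ((if (0, i') = ((2:Fin 3), k) then 1 else 0) + if (2, j') = ((2:Fin 3), k) then 1 else 0) = _
      simp
    have e3 : ∀ i' j', (φ + d0 (fun p => if p = (2, k) then 1 else 0)).bc i' j' =
      φ.bc i' j' + if j' = k then 1 else 0 := by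
      intro i' j'
      show φ.bc i' j' + ((if (1, i') = ((2:Fin 3), k) then 1 else 0) + if (2, j') = ((2:Fin 3), k) then 1 else 0) = _
      simp
    simp only [e1, e2, e3] at h
    have a1 := sum_flip2 φ.ac k
    have a2 := sum_flip2 φ.bc k
    simp only [dg, Fintype.sum_sum_type, wt, sum_const_zero]
    omega

def HV {n d : ℕ} (φ : Cochain1 n) (Ls : Fin d → LatinSquare n) : (Fin n ⊕ Fin n ⊕ Fin n) → ℕ
  | .inl i => HH (tauA i) (univ.filter fun j => φ.ab i j ≠ 0) (univ.filter fun k => φ.ac i k ≠ 0) Ls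
  | .inr (.inl j) => HH (tauB j) (univ.filter fun i => φ.ab i j ≠ 0) (univ.filter fun k => φ.bc j k ≠ 0) Ls
  | .inr (.inr k) => HH (tauC k) (univ.filter fun i => φ.ac i k ≠ 0) (univ.filter fun j => φ.bc j k ≠ 0) Ls

lemma hits_eq {n : ℕ} (f g : Fin n → ZMod 2) (σ : Equiv.Perm (Fin n)) :
    hits (univ.filter fun j => f j ≠ 0) (univ.filter fun k => g k ≠ 0) σ =
      ∑ x, chi (f x) * chi (g (σ x)) := by
  rw [hits, filter_filter, card_filter]
  refine sum_congr rfl fun x _ => ?_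
  simp only [mem_filter, mem_univ, true_and, chi]
  split_ifs <;> simp_all

lemma chi3 (x y z : ZMod 2) : chi x + chi y + chi z ≤
    chi (x + y + z) + 2 * (chi x * chi y + chi x * chi z + chi y * chi z) := by
  unfold chi; revert x y z; decide

lemma odd_lower {n : ℕ} (φ : Cochain1 n) (L : LatinSquare n) :
    norm1 φ ≤ ∑ i, ∑ j, chi (d1 φ i j (L.1 i j)) +
     2 * (∑ i, hits (univ.filter fun j => φ.ab i j ≠ 0) (univ.filter fun k => φ.ac i k ≠ 0) (tauA i L) +
       ∑ j, hits (univ.filter fun i => φ.ab i j ≠ 0) (univ.filter fun k => φ.bc j k ≠ 0) (tauB j L) +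
       ∑ k, hits (univ.filter fun i => φ.ac i k ≠ 0) (univ.filter fun j => φ.bc j k ≠ 0) (tauC k L)) := by
  have h := sum_le_sum fun i (_ : i ∈ (univ : Finset (Fin n))) => sum_le_sum fun j (_ : j ∈ (univ : Finset (Fin n))) =>
    chi3 (φ.ab i j) (φ.ac i (L.1 i j)) (φ.bc j (L.1 i j))
  simp only [sum_add_distrib, ← mul_sum] at h
  have e1 : ∑ i, ∑ j, chi (φ.ac i (L.1 i j)) = ∑ i, ∑ k, chi (φ.ac i k) :=
    sum_congr rfl fun i _ => Equiv.sum_comp (L.1 i) (fun k => chi (φ.ac i k))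
  have e2 : ∑ i, ∑ j, chi (φ.bc j (L.1 i j)) = ∑ j, ∑ k, chi (φ.bc j k) := by
    rw [sum_comm]
    exact sum_congr rfl fun j _ => Equiv.sum_comp (tauB j L) (fun k => chi (φ.bc j k))
  have e3 : ∑ j, hits (univ.filter fun i => φ.ab i j ≠ 0) (univ.filter fun k => φ.bc j k ≠ 0) (tauB j L)
      = ∑ i, ∑ j, chi (φ.ab i j) * chi (φ.bc j (L.1 i j)) := by
    simp only [hits_eq]; rw [sum_comm]; rfl
  have e4 : ∑ k, hits (univ.filter fun i => φ.ac i k ≠ 0) (univ.filter fun j => φ.bc j k ≠ 0) (tauC k L)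
      = ∑ i, ∑ j, chi (φ.ac i (L.1 i j)) * chi (φ.bc j (L.1 i j)) := by
    rw [sum_congr rfl (fun k _ => hits_eq (fun i => φ.ac i k) (fun j => φ.bc j k) (tauC k L))]
    rw [sum_comm]
    refine sum_congr rfl fun i _ => ?_
    rw [← Equiv.sum_comp (L.1 i)]
    refine sum_congr rfl fun j _ => ?_
    show _ * chi (φ.bc ((L.1 i).symm (L.1 i j)) (L.1 i j)) = _
    rw [Equiv.symm_apply_apply]
  have e5 : ∑ i, hits (univ.filter fun j => φ.ab i j ≠ 0) (univ.filter fun k => φ.ac i k ≠ 0) (tauA i L)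
      = ∑ i, ∑ j, chi (φ.ab i j) * chi (φ.ac i (L.1 i j)) := by
    simp only [hits_eq]; rfl
  rw [e1, e2] at h
  rw [e3, e4, e5, norm1_eq]
  exact h

lemma triangles_count {n d : ℕ} (φ : Cochain1 n) (Ls : Fin d → LatinSquare n) (m : Fin d) :
    (univ.filter fun p : Fin n × Fin n => d1 φ p.1 p.2 ((Ls m).1 p.1 p.2) ≠ 0).card ≤
      normd1 (triangles Ls) φ := by
  unfold normd1
  refine Finset.card_le_card_of_injOn (fun p => (p.1, p.2, (Ls m).1 p.1 p.2)) ?_ ?_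
  · intro p hp
    have hp := (mem_filter.mp (mem_coe.mp hp)).2
    simp only [mem_coe, mem_filter, triangles, mem_univ, true_and]
    exact ⟨⟨m, rfl⟩, hp⟩
  · rintro ⟨a, b⟩ _ ⟨a', b'⟩ _ h
    simp only [Prod.mk.injEq] at h
    simp [h.1, h.2.1]

lemma small_case {n d : ℕ} (hn : 0 < n) (hd : 0 < d) (φ : Cochain1 n) (Ls : Fin d → LatinSquare n)
    (hmin : ∀ ψ, norm1 φ ≤ norm1 (φ + d0 ψ))
    (hA : ∀ i, GoodT (tauA i) Ls) (hB : ∀ i, GoodT (tauB i) Ls) (hC : ∀ i, GoodT (tauC i) Ls)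
    (hN : (norm1 φ : ℝ) ≤ cst ^ 2 / 20 * n ^ 2) :
    12 / 1000 * (norm1 φ : ℝ) ≤ normd1 (triangles Ls) φ := by
  have hn' : (0:ℝ) < n := by exact_mod_cast hn
  have hd' : (0:ℝ) < d := by exact_mod_cast hd
  have hc := cst_pos
  -- counting
  have h1 : d * norm1 φ ≤ d * normd1 (triangles Ls) φ + 2 * ∑ v, HV φ Ls v := by
    have a : ∀ m : Fin d, norm1 φ ≤ normd1 (triangles Ls) φ + 
     2 * (∑ i, hits (univ.filter fun j => φ.ab i j ≠ 0) (univ.filter fun k => φ.ac i k ≠ 0) (tauA i (Ls m)) +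
       ∑ j, hits (univ.filter fun i => φ.ab i j ≠ 0) (univ.filter fun k => φ.bc j k ≠ 0) (tauB j (Ls m)) +
       ∑ k, hits (univ.filter fun i => φ.ac i k ≠ 0) (univ.filter fun j => φ.bc j k ≠ 0) (tauC k (Ls m))) := by
      intro m
      refine (odd_lower φ (Ls m)).trans (Nat.add_le_add_right (le_trans (le_of_eq ?_) (triangles_count φ Ls m)) _)
      simp only [card_filter, ← Finset.univ_product_univ, Finset.sum_product, chi]
    have b := sum_le_sum fun m (_ : m ∈ (univ : Finset (Fin d))) => a m
    simp only [sum_const, card_univ, Fintype.card_fin, smul_eq_mul, sum_add_distrib, ← mul_sum] at b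
    refine b.trans (le_of_eq ?_)
    rw [Fintype.sum_sum_type, Fintype.sum_sum_type]
    simp only [HV, HH]
    rw [sum_comm, sum_comm (s := univ) (t := (univ : Finset (Fin n))) (f := fun m j => hits (univ.filter fun i => φ.ab i j ≠ 0) (univ.filter fun k => φ.bc j k ≠ 0) (tauB j (Ls m))),
      sum_comm (s := univ) (t := (univ : Finset (Fin n))) (f := fun m k => hits (univ.filter fun i => φ.ac i k ≠ 0) (univ.filter fun j => φ.bc j k ≠ 0) (tauC k (Ls m)))]
    ring
  have hdg := dg_le φ hmin
  have good : ∀ v, (0 < dg φ v → (dg φ v : ℝ) ≤ cst * n → (HV φ Ls v : ℝ) ≤ 1/100 * d * dg φ v) ∧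
      (cst * n ≤ dg φ v → (HV φ Ls v : ℝ) ≤ 45/100 * d * dg φ v) := by
    rintro (i | j | k)
    · have hdi := hdg (.inl i)
      rw [dgA] at hdi ⊢
      have := hA i (univ.filter fun j => φ.ab i j ≠ 0) (univ.filter fun k => φ.ac i k ≠ 0)
      exact ⟨this.1, fun h => this.2 h hdi⟩
    · have hdi := hdg (.inr (.inl j))
      rw [dgB] at hdi ⊢
      have := hB j (univ.filter fun i => φ.ab i j ≠ 0) (univ.filter fun k => φ.bc j k ≠ 0)
      exact ⟨this.1, fun h => this.2 h hdi⟩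
    · have hdi := hdg (.inr (.inr k))
      rw [dgC] at hdi ⊢
      have := hC k (univ.filter fun i => φ.ac i k ≠ 0) (univ.filter fun j => φ.bc j k ≠ 0)
      exact ⟨this.1, fun h => this.2 h hdi⟩
  have zero : ∀ v, dg φ v = 0 → HV φ Ls v = 0 := by
    have hz : ∀ (τ : LatinSquare n → Equiv.Perm (Fin n)) (A B : Finset (Fin n)), A.card + B.card = 0 →
        HH τ A B Ls = 0 := by
      intro τ A B h
      have : A = ∅ := card_eq_zero.mp (by omega)
      subst this; simp [HH, hits]
    rintro (i | j | k) h
    · rw [dgA] at h; exact hz _ _ _ h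
    · rw [dgB] at h; exact hz _ _ _ h
    · rw [dgC] at h; exact hz _ _ _ h
  let H : Finset (Fin n ⊕ Fin n ⊕ Fin n) := univ.filter fun v => cst * n < dg φ v
  set h : ℝ := ∑ v ∈ H, (dg φ v : ℝ) with hh
  set l : ℝ := ∑ v ∈ Hᶜ, (dg φ v : ℝ) with hl
  have hsum : h + l = 2 * norm1 φ := by
    rw [hh, hl, sum_add_sum_compl]; exact_mod_cast sum_dg φ
  have hHV : ∑ v, (HV φ Ls v : ℝ) ≤ 45/100 * d * h + 1/100 * d * l := by
    rw [← sum_add_sum_compl H, hh, hl, mul_sum, mul_sum]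
    refine add_le_add (sum_le_sum fun v hv => ?_) (sum_le_sum fun v hv => ?_)
    · exact (good v).2 ((mem_filter.mp hv).2).le
    · rcases Nat.eq_zero_or_pos (dg φ v) with h0 | h0
      · rw [zero v h0, h0]; simp
      · refine (good v).1 h0 ?_
        simpa [H] using hv
  have hhl : h ≤ l + (H.card : ℝ)^2 := by
    rw [hh, hl]; exact_mod_cast high_low φ H
  have hHc : (H.card : ℝ) * (cst * n) ≤ h := by
    rw [hh, ← nsmul_eq_mul]
    exact Finset.card_nsmul_le_sum _ _ _ fun v hv => ((mem_filter.mp hv).2).le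
  have hl0 : 0 ≤ l := by rw [hl]; positivity
  have hh0 : 0 ≤ h := by rw [hh]; positivity
  have hX : (H.card : ℝ)^2 ≤ h / 10 := by
    have a : (H.card : ℝ) * (cst * n) ≤ cst^2 / 10 * n^2 := by linarith
    have b : ((H.card : ℝ) * (cst * n)) * ((H.card : ℝ) * (cst * n)) ≤ h * (cst^2 / 10 * n^2) :=
      mul_le_mul hHc a (by positivity) hh0
    have e : (cst * n)^2 * (H.card : ℝ)^2 ≤ (cst * n)^2 * (h / 10) := by nlinarith
    exact le_of_mul_le_mul_left e (by positivity)
  have h1' : (d:ℝ) * norm1 φ ≤ d * normd1 (triangles Ls) φ + 2 * ∑ v, (HV φ Ls v : ℝ) := by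
    exact_mod_cast h1
  have hfin : (d:ℝ) * norm1 φ ≤ d * normd1 (triangles Ls) φ + d * (2 * (45/100 * h + 1/100 * l)) := by
    linarith
  have hfin2 : (d:ℝ) * norm1 φ ≤ d * (normd1 (triangles Ls) φ + (2 * (45/100 * h + 1/100 * l))) := by linarith
  have hfin3 := le_of_mul_le_mul_left hfin2 hd'
  linarith


lemma edge_deg {n d : ℕ} (Ls : Fin d → LatinSquare n) : edgeDegLE (triangles Ls) d := by
  have key : ∀ (P : Fin n × Fin n × Fin n → Prop) (f : Fin d → Fin n × Fin n × Fin n),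
      (∀ t m, P t → (Ls m).1 t.1 t.2.1 = t.2.2 → t = f m) →
      ((triangles Ls).filter P).card ≤ d := by
    intro P f h
    calc _ ≤ (univ.image f).card := by
          apply card_le_card
          intro t ht
          simp only [triangles, mem_filter, mem_univ, true_and] at ht
          obtain ⟨⟨m, hm⟩, hP⟩ := ht
          rw [mem_image]
          exact ⟨m, mem_univ _, (h t m hP hm).symm⟩
      _ ≤ d := card_image_le.trans (by simp)
  refine ⟨fun i j => ?_, fun i k => ?_, fun j k => ?_⟩
  · have := key (fun t => t.1 = i ∧ t.2.1 = j) (fun m => (i, j, (Ls m).1 i j)) ?_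
    · convert this
    · rintro ⟨a, b, c⟩ m ⟨h1, h2⟩ h3
      simp only at h1 h2 h3
      subst h1 h2 h3; rfl
  · have := key (fun t => t.1 = i ∧ t.2.2 = k) (fun m => (i, ((Ls m).1 i).symm k, k)) ?_
    · convert this
    · rintro ⟨a, b, c⟩ m ⟨h1, h2⟩ h3
      simp only at h1 h2 h3
      subst h1 h2 h3; simp
  · have := key (fun t => t.2.1 = j ∧ t.2.2 = k) (fun m => ((tauB j (Ls m)).symm k, j, k)) ?_
    · convert this
    · rintro ⟨a, b, c⟩ m ⟨h1, h2⟩ h3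
      simp only at h1 h2 h3
      subst h1 h2
      have : a = (tauB b (Ls m)).symm c := by
        rw [Equiv.eq_symm_apply]; exact h3
      rw [← this]

lemma cochain_ext {n : ℕ} {φ η : Cochain1 n} (h1 : ∀ i j, φ.ab i j = η.ab i j)
    (h2 : ∀ i j, φ.ac i j = η.ac i j) (h3 : ∀ i j, φ.bc i j = η.bc i j) : φ = η := by
  cases φ; cases η
  simp only [Cochain1.mk.injEq]
  exact ⟨funext fun i => funext fun j => h1 i j, funext fun i => funext fun j => h2 i j,
    funext fun i => funext fun j => h3 i j⟩

lemma z2_add_self (x : ZMod 2) : x + x = 0 := by revert x; decide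

lemma z2_eq {x y : ZMod 2} (h : x + y = 0) : x = y := by revert x y; decide

lemma exists_min {n : ℕ} (φ : Cochain1 n) : ∃ ψ, norm1 (φ + d0 ψ) = normClass1 φ := by
  have := Nat.sInf_mem (s := Set.range fun ψ : Fin 3 × Fin n → ZMod 2 => norm1 (φ + d0 ψ))
    (Set.range_nonempty _)
  exact this

lemma add_d0_d0 {n : ℕ} (φ : Cochain1 n) (ψ ψ') : φ + d0 ψ + d0 ψ' = φ + d0 (fun v => ψ v + ψ' v) := by
  apply cochain_ext
  · intro i j
    show φ.ab i j + (ψ (0,i) + ψ (1,j)) + (ψ' (0,i) + ψ' (1,j)) = φ.ab i j + ((ψ (0,i) + ψ' (0,i)) + (ψ (1,j) + ψ' (1,j)))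
    ring
  · intro i j
    show φ.ac i j + (ψ (0,i) + ψ (2,j)) + (ψ' (0,i) + ψ' (2,j)) = φ.ac i j + ((ψ (0,i) + ψ' (0,i)) + (ψ (2,j) + ψ' (2,j)))
    ring
  · intro i j
    show φ.bc i j + (ψ (1,i) + ψ (2,j)) + (ψ' (1,i) + ψ' (2,j)) = φ.bc i j + ((ψ (1,i) + ψ' (1,i)) + (ψ (2,j) + ψ' (2,j)))
    ring

lemma normClass_pos {n : ℕ} (φ : Cochain1 n) (h : ¬ IsCobound1 φ) : 0 < normClass1 φ := by
  obtain ⟨ψ, hψ⟩ := exists_min φ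
  by_contra h0
  have h0 : norm1 (φ + d0 ψ) = 0 := by omega
  apply h
  refine ⟨ψ, ?_⟩
  unfold norm1 at h0
  simp only [Nat.add_eq_zero_iff, card_eq_zero, filter_eq_empty_iff, mem_univ, true_implies, not_not] at h0
  obtain ⟨⟨h1, h2⟩, h3⟩ := h0
  exact cochain_ext (fun i j => z2_eq (h1 (x := (i, j)))) (fun i j => z2_eq (h2 (x := (i, j))))
    (fun i j => z2_eq (h3 (x := (i, j))))

lemma norm1_le {n : ℕ} (φ : Cochain1 n) : norm1 φ ≤ 3 * n ^ 2 := by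
  have : ∀ P : Fin n × Fin n → Prop, (univ.filter P).card ≤ n ^ 2 := by
    intro P
    refine (card_le_univ _).trans ?_
    simp; nlinarith
  unfold norm1
  have h1 := this (fun p : Fin n × Fin n => φ.ab p.1 p.2 ≠ 0)
  have h2 := this (fun p : Fin n × Fin n => φ.ac p.1 p.2 ≠ 0)
  have h3 := this (fun p : Fin n × Fin n => φ.bc p.1 p.2 ≠ 0)
  have h1 : (univ.filter fun p : Fin n × Fin n => φ.ab p.1 p.2 ≠ 0).card ≤ n ^ 2 := by convert h1
  have h2 : (univ.filter fun p : Fin n × Fin n => φ.ac p.1 p.2 ≠ 0).card ≤ n ^ 2 := by convert h2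
  have h3 : (univ.filter fun p : Fin n × Fin n => φ.bc p.1 p.2 ≠ 0).card ≤ n ^ 2 := by convert h3
  omega

/-- Good tuples. -/
def AllGood {n d : ℕ} (γ : ℝ) (Ls : Fin d → LatinSquare n) : Prop :=
  (∀ i, GoodT (tauA i) Ls) ∧ (∀ i, GoodT (tauB i) Ls) ∧ (∀ i, GoodT (tauC i) Ls) ∧
  ∀ φ : Cochain1 n, cst ^ 2 / 20 * n ^ 2 < (normClass1 φ : ℝ) →
    γ * (n:ℝ) ^ 2 < (normd1 (triangles Ls) φ : ℝ)

lemma good_h1 {n d : ℕ} (hn : 0 < n) (hd : 0 < d) {γ : ℝ} (hγ : 0 < γ) (Ls : Fin d → LatinSquare n)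
    (h : AllGood γ Ls) : min (12 / 1000) (γ / 3) ≤ h1 (triangles Ls) := by
  obtain ⟨hA, hB, hC, hL⟩ := h
  unfold h1
  refine le_csInf ?_ ?_
  · refine ⟨_, ⟨fun _ _ => 1, fun _ _ => 0, fun _ _ => 0⟩, ?_, rfl⟩
    rintro ⟨ψ, hψ⟩
    have h1 : d1 (⟨fun _ _ => 1, fun _ _ => 0, fun _ _ => 0⟩ : Cochain1 n) ⟨0, hn⟩ ⟨0, hn⟩ ⟨0, hn⟩ = 1 := by
      simp [d1]
    rw [hψ] at h1
    have h2 : d1 (d0 ψ) ⟨0, hn⟩ ⟨0, hn⟩ ⟨0, hn⟩ = 0 := by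
      simp only [d1, d0]
      linear_combination z2_add_self (ψ (0, ⟨0, hn⟩)) + z2_add_self (ψ (1, ⟨0, hn⟩)) + z2_add_self (ψ (2, ⟨0, hn⟩))
    rw [h2] at h1
    exact absurd h1 (by decide)
  · rintro r ⟨φ, hφ, rfl⟩
    have hp := normClass_pos φ hφ
    have hp' : (0:ℝ) < normClass1 φ := by exact_mod_cast hp
    rw [le_div_iff₀ hp']
    by_cases hbig : cst ^ 2 / 20 * n ^ 2 < (normClass1 φ : ℝ)
    · have h1 := hL φ hbig
      have h2 : (normClass1 φ : ℝ) ≤ 3 * (n:ℝ) ^ 2 := by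
        exact_mod_cast (normClass1_le φ (fun _ => 0)).trans (norm1_le _)
      calc _ ≤ γ / 3 * normClass1 φ := by gcongr; exact min_le_right _ _
        _ ≤ γ / 3 * (3 * (n:ℝ) ^ 2) := by gcongr
        _ = γ * (n:ℝ)^2 := by ring
        _ ≤ _ := h1.le
    · obtain ⟨ψ, hψ⟩ := exists_min φ
      have h1 := small_case hn hd (φ + d0 ψ) Ls (by
        intro ψ'
        rw [add_d0_d0, hψ]; exact normClass1_le _ _) hA hB hC (by rw [hψ]; exact not_lt.mp hbig)
      have h2 : normd1 (triangles Ls) (φ + d0 ψ) = normd1 (triangles Ls) φ := by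
        unfold normd1; simp only [d1_add_d0]
      rw [hψ, h2] at h1
      refine le_trans ?_ h1
      gcongr
      exact min_le_left _ _

lemma big_bad {n d : ℕ} (c3 γ : ℝ) (hn : 0 < n) (hd : 4 ≤ c3 * d)
    (hdev : ∀ E : Fin n → Fin n → Fin n → Prop, (cst ^ 2 / 20 / 7) * (n:ℝ) ^ 3 ≤ ∑ i, ∑ j, (eC E i j : ℝ) →
      ((univ.filter fun L : LatinSquare n =>
        ((univ.filter fun p : Fin n × Fin n => E p.1 p.2 (L.1 p.1 p.2)).card : ℝ) ≤ γ * (n:ℝ)^2).card : ℝ)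
      ≤ Real.exp (- (c3 * (n:ℝ)^2)) * Fintype.card (LatinSquare n)) :
    ((univ.filter fun Ls : Fin d → LatinSquare n => ¬ ∀ φ : Cochain1 n,
      cst ^ 2 / 20 * n ^ 2 < (normClass1 φ : ℝ) →
      γ * (n:ℝ) ^ 2 < (normd1 (triangles Ls) φ : ℝ)).card : ℝ) ≤
      (Fintype.card (LatinSquare n) : ℝ) ^ d * (1 / n) := by
  have hn' : (1:ℝ) ≤ n := by exact_mod_cast hn
  set N : ℝ := (Fintype.card (LatinSquare n) : ℝ) with hN
  let mk : (Fin 3 → Fin n → Fin n → ZMod 2) → Cochain1 n := fun f => ⟨f 0, f 1, f 2⟩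
  let S : Finset (Fin 3 → Fin n → Fin n → ZMod 2) :=
    univ.filter fun f => cst ^ 2 / 20 * n ^ 2 < (normClass1 (mk f) : ℝ)
  let F : (Fin 3 → Fin n → Fin n → ZMod 2) → Finset (Fin d → LatinSquare n) := fun f =>
    univ.filter fun Ls => (normd1 (triangles Ls) (mk f) : ℝ) ≤ γ * (n:ℝ) ^ 2
  have hsub : (univ.filter fun Ls : Fin d → LatinSquare n => ¬ ∀ φ : Cochain1 n,
      cst ^ 2 / 20 * n ^ 2 < (normClass1 φ : ℝ) →
      γ * (n:ℝ) ^ 2 < (normd1 (triangles Ls) φ : ℝ)) ⊆ S.biUnion F := by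
    intro Ls hLs
    have h := (mem_filter.mp hLs).2
    push Not at h
    obtain ⟨φ, h1, h2⟩ := h
    rw [mem_biUnion]
    have e : mk ![φ.ab, φ.ac, φ.bc] = φ := rfl
    refine ⟨![φ.ab, φ.ac, φ.bc], ?_, ?_⟩
    · simp only [S, mem_filter, mem_univ, true_and, e]; exact h1
    · simp only [F, mem_filter, mem_univ, true_and, e]; exact h2
  have hF : ∀ f ∈ S, ((F f).card : ℝ) ≤ (Real.exp (- (c3 * (n:ℝ)^2)) * N) ^ d := by
    intro f hf
    have hf := (mem_filter.mp hf).2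
    set φ := mk f with hφ
    have hE := hdev (fun i j k => d1 φ i j k ≠ 0) (by
      have h1 := Tn_exp φ
      have h2 : ∑ i, ∑ j, (eC (fun i j k => d1 φ i j k ≠ 0) i j : ℝ) =
          ((∑ i, ∑ j, ∑ k, chi (d1 φ i j k) : ℕ) : ℝ) := by
        push_cast
        refine sum_congr rfl fun i _ => sum_congr rfl fun j _ => ?_
        simp [eC, chi, card_filter]
      rw [h2]
      have h3 : (n:ℝ) * normClass1 φ ≤ 7 * ((∑ i, ∑ j, ∑ k, chi (d1 φ i j k) : ℕ) : ℝ) := by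
        exact_mod_cast h1
      have h4 : (n:ℝ) * (cst ^ 2 / 20 * n ^ 2) ≤ n * normClass1 φ := by gcongr
      nlinarith)
    set G : Finset (LatinSquare n) := univ.filter fun L : LatinSquare n =>
        ((univ.filter fun p : Fin n × Fin n => d1 φ p.1 p.2 (L.1 p.1 p.2) ≠ 0).card : ℝ) ≤ γ * (n:ℝ)^2 with hG
    have hE' : (G.card : ℝ) ≤ Real.exp (- (c3 * (n:ℝ)^2)) * N := by
      convert hE
    have hFG : F f ⊆ Fintype.piFinset fun _ : Fin d => G := by
      intro Ls hLs
      have hLs := (mem_filter.mp hLs).2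
      rw [Fintype.mem_piFinset]
      intro m
      rw [hG, mem_filter]
      refine ⟨mem_univ _, le_trans ?_ hLs⟩
      exact_mod_cast triangles_count φ Ls m
    have := card_le_card hFG
    rw [Fintype.card_piFinset_const] at this
    calc ((F f).card : ℝ) ≤ (G.card : ℝ) ^ d := by exact_mod_cast this
      _ ≤ _ := by gcongr
  have hS : (S.card : ℝ) ≤ Real.exp (3 * (n:ℝ)^2) := by
    have h1 : S.card ≤ 2 ^ (3 * n^2) := by
      refine (card_le_univ _).trans (le_of_eq ?_)
      simp only [Fintype.card_fun, ZMod.card, Fintype.card_fin]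
      rw [← pow_mul, ← pow_mul]; congr 1; ring
    calc (S.card : ℝ) ≤ (2:ℝ) ^ (3 * n^2) := by exact_mod_cast h1
      _ ≤ (Real.exp 1) ^ (3 * n^2) := by
          gcongr; have := Real.add_one_le_exp (1:ℝ); linarith
      _ = _ := by rw [← Real.exp_nat_mul]; push_cast; rw [mul_one]
  calc _ ≤ ∑ f ∈ S, ((F f).card : ℝ) := by
        exact_mod_cast (card_le_card hsub).trans card_biUnion_le
    _ ≤ ∑ f ∈ S, (Real.exp (- (c3 * (n:ℝ)^2)) * N) ^ d := sum_le_sum hF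
    _ = S.card * (Real.exp (- (c3 * (n:ℝ)^2)) * N) ^ d := by rw [sum_const, nsmul_eq_mul]
    _ ≤ Real.exp (3 * (n:ℝ)^2) * (Real.exp (- (c3 * (n:ℝ)^2)) * N) ^ d := by gcongr
    _ = N ^ d * Real.exp (3 * (n:ℝ)^2 - (c3 * d) * (n:ℝ)^2) := by
        rw [mul_pow, ← Real.exp_nat_mul, ← mul_assoc, ← Real.exp_add, mul_comm]; congr 2; ring
    _ ≤ N ^ d * Real.exp (- n) := by
        gcongr
        nlinarith
    _ ≤ _ := by
        gcongr
        rw [Real.exp_neg, one_div]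
        gcongr
        have := Real.add_one_le_exp (n:ℝ)
        linarith

lemma all_bad {n d : ℕ} (c3 γ : ℝ) (hn : 0 < n) (hd1 : 1000 ≤ d) (hd2 : 40 ≤ cst * d) (hd : 4 ≤ c3 * d)
    (hdev : ∀ E : Fin n → Fin n → Fin n → Prop, (cst ^ 2 / 20 / 7) * (n:ℝ) ^ 3 ≤ ∑ i, ∑ j, (eC E i j : ℝ) →
      ((univ.filter fun L : LatinSquare n =>
        ((univ.filter fun p : Fin n × Fin n => E p.1 p.2 (L.1 p.1 p.2)).card : ℝ) ≤ γ * (n:ℝ)^2).card : ℝ)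
      ≤ Real.exp (- (c3 * (n:ℝ)^2)) * Fintype.card (LatinSquare n)) :
    ((univ.filter fun Ls : Fin d → LatinSquare n => ¬ AllGood γ Ls).card : ℝ) ≤
      (Fintype.card (LatinSquare n) : ℝ) ^ d * (16 / n) := by
  have hn' : (0:ℝ) < n := by exact_mod_cast hn
  set N : ℝ := (Fintype.card (LatinSquare n) : ℝ) ^ d with hN
  have hv : ∀ τ : Fin n → LatinSquare n → Equiv.Perm (Fin n), (∀ i, Equivar (τ i)) →
      ((univ.filter fun Ls : Fin d → LatinSquare n => ¬ ∀ i, GoodT (τ i) Ls).card : ℝ) ≤ N * (5 / n) := by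
    intro τ hτ
    have hsub : (univ.filter fun Ls : Fin d → LatinSquare n => ¬ ∀ i, GoodT (τ i) Ls) ⊆
        (univ : Finset (Fin n)).biUnion fun i =>
          univ.filter fun Ls : Fin d → LatinSquare n => ¬ GoodT (τ i) Ls := by
      intro Ls hLs
      have h := (mem_filter.mp hLs).2
      push Not at h
      obtain ⟨i, hi⟩ := h
      rw [mem_biUnion]
      exact ⟨i, mem_univ _, by simpa using hi⟩
    calc _ ≤ ∑ i : Fin n, ((univ.filter fun Ls : Fin d → LatinSquare n => ¬ GoodT (τ i) Ls).card : ℝ) := by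
          exact_mod_cast (card_le_card hsub).trans card_biUnion_le
      _ ≤ ∑ i : Fin n, N * (5 / (n:ℝ)^2) := sum_le_sum fun i _ => link_bad hn hd1 hd2 (τ i) (hτ i)
      _ = _ := by
          rw [sum_const, card_univ, Fintype.card_fin, nsmul_eq_mul]; field_simp
  have hA := hv tauA equivarA
  have hB := hv tauB equivarB
  have hC := hv tauC equivarC
  have hD := big_bad (d := d) c3 γ hn hd hdev
  have hsub : (univ.filter fun Ls : Fin d → LatinSquare n => ¬ AllGood γ Ls) ⊆
      (univ.filter fun Ls : Fin d → LatinSquare n => ¬ ∀ i, GoodT (tauA i) Ls) ∪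
      ((univ.filter fun Ls : Fin d → LatinSquare n => ¬ ∀ i, GoodT (tauB i) Ls) ∪
      ((univ.filter fun Ls : Fin d → LatinSquare n => ¬ ∀ i, GoodT (tauC i) Ls) ∪
      (univ.filter fun Ls : Fin d → LatinSquare n => ¬ ∀ φ : Cochain1 n,
      cst ^ 2 / 20 * n ^ 2 < (normClass1 φ : ℝ) →
      γ * (n:ℝ) ^ 2 < (normd1 (triangles Ls) φ : ℝ)))) := by
    intro Ls hLs
    have h := (mem_filter.mp hLs).2
    unfold AllGood at h
    simp only [mem_union, mem_filter, mem_univ, true_and]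
    tauto
  have hc := (card_le_card hsub).trans ((card_union_le _ _).trans (Nat.add_le_add_left
    ((card_union_le _ _).trans (Nat.add_le_add_left (card_union_le _ _) _)) _))
  have hc' : ((univ.filter fun Ls : Fin d → LatinSquare n => ¬ AllGood γ Ls).card : ℝ) ≤ _ := Nat.cast_le.mpr hc
  push_cast at hc'
  have e : N * (16 / n) = N * (5 / n) + (N * (5 / n) + (N * (5 / n) + N * (1 / n))) := by ring
  rw [e]
  refine hc'.trans ?_
  refine add_le_add hA (add_le_add hB (add_le_add hC hD))

/-- **Theorem (Lubotzky–Meshulam).** There exist `ε > 0` and `d < ∞` such that the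
random complex `Y(L_1,…,L_d) ∈ 𝓨(n,d)` built from `d` independent uniform Latin squares
of order `n` satisfies `h_1(Y) > ε` (and has maximal edge degree at most `d`)
asymptotically almost surely as `n → ∞`. -/
theorem exists_bounded_degree_two_dimensional_expanders :
    ∃ ε : ℝ, 0 < ε ∧ ∃ d : ℕ,
      Filter.Tendsto
        (fun n : ℕ =>
          (((univ : Finset (Fin d → LatinSquare n)).filter fun Ls =>
              ε < h1 (triangles Ls) ∧ edgeDegLE (triangles Ls) d).card : ℝ) /
            ((univ : Finset (Fin d → LatinSquare n)).card : ℝ))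
        Filter.atTop (nhds 1) := by
  have hc := cst_pos
  have hc1 : cst ≤ 1 := by
    unfold cst; rw [Real.exp_le_one_iff]; norm_num
  obtain ⟨c3, hc3, γ, hγ, hdev⟩ := large_dev (cst ^ 2 / 20 / 7) (by positivity) (by nlinarith)
  refine ⟨min (12 / 1000) (γ / 3) / 2, by positivity, ?_⟩
  obtain ⟨d, hd⟩ := exists_nat_ge (1000 + 40 / cst + 4 / c3)
  have p1 : 0 < 40 / cst := by positivity
  have p2 : 0 < 4 / c3 := by positivity
  have hd1 : 1000 ≤ d := by
    have : (1000:ℝ) ≤ d := by linarith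
    exact_mod_cast this
  have hd2 : 40 ≤ cst * d := by
    have : 40 / cst ≤ d := by linarith
    rw [div_le_iff₀ hc] at this; linarith
  have hd3 : 4 ≤ c3 * d := by
    have : 4 / c3 ≤ d := by linarith
    rw [div_le_iff₀ hc3] at this; linarith
  refine ⟨d, ?_⟩
  have hlim : Filter.Tendsto (fun n : ℕ => 1 - 16 / (n:ℝ)) Filter.atTop (nhds 1) := by
    have := (tendsto_const_div_atTop_nhds_zero_nat (16:ℝ)).const_sub 1
    simpa using this
  refine tendsto_of_tendsto_of_tendsto_of_le_of_le' hlim tendsto_const_nhds ?_ ?_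
  · filter_upwards [hdev, Filter.eventually_ge_atTop 1] with n hdn hn
    have hb := all_bad (d := d) c3 γ hn hd1 hd2 hd3 hdn
    have hN := latin_pos n
    have hcard : ((univ : Finset (Fin d → LatinSquare n)).card : ℝ) =
        (Fintype.card (LatinSquare n) : ℝ) ^ d := by
      rw [card_univ, Fintype.card_fun, Fintype.card_fin]; push_cast; rfl
    rw [hcard, le_div_iff₀ (by positivity)]
    have hsplit := Finset.card_filter_add_card_filter_not (s := (univ : Finset (Fin d → LatinSquare n)))
      (fun Ls => AllGood γ Ls)
    have hsplit' : ((univ.filter fun Ls : Fin d → LatinSquare n => AllGood γ Ls).card : ℝ) +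
        ((univ.filter fun Ls : Fin d → LatinSquare n => ¬ AllGood γ Ls).card : ℝ) =
        (Fintype.card (LatinSquare n) : ℝ) ^ d := by
      rw [← hcard]; exact_mod_cast hsplit
    have hmono : ((univ.filter fun Ls : Fin d → LatinSquare n => AllGood γ Ls).card : ℝ) ≤
        ((univ.filter fun Ls : Fin d → LatinSquare n =>
          min (12 / 1000) (γ / 3) / 2 < h1 (triangles Ls) ∧ edgeDegLE (triangles Ls) d).card : ℝ) := by
      have : (univ.filter fun Ls : Fin d → LatinSquare n => AllGood γ Ls) ⊆
        (univ.filter fun Ls : Fin d → LatinSquare n =>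
          min (12 / 1000) (γ / 3) / 2 < h1 (triangles Ls) ∧ edgeDegLE (triangles Ls) d) := by
        intro Ls hLs
        have h := (mem_filter.mp hLs).2
        rw [mem_filter]
        refine ⟨mem_univ _, ?_, edge_deg Ls⟩
        have hg := good_h1 hn (by omega) hγ Ls h
        have hp : (0:ℝ) < min (12 / 1000) (γ / 3) := by positivity
        linarith
      exact_mod_cast card_le_card this
    linarith
  · refine Filter.Eventually.of_forall fun n => ?_
    refine div_le_one_of_le₀ ?_ (Nat.cast_nonneg _)
    exact_mod_cast card_le_card (filter_subset _ _)
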